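/- Let Γ be a non-elementary hyperbolic group. For any hyperbolic metric d ∈ 𝒟_Γ and any word metric d_S on Γ, there exist constants c₁, c₂ > 0 such that c₁ ≤ Σ_{x∈𝐒_n} exp(−gr(d)·d(o,x)) ≤ c₂ for all integers n ≥ 0, where 𝐒_n := {x ∈ Γ : d_S(o,x) = n}. -/

import Mathlib

open MeasureTheory Filter Topology
open scoped ENNReal NNReal

noncomputable section

namespace HypFlow

/-! ## Word metrics, hyperbolic metrics on groups, growth rates -/

variable {Γ : Type*}

/-- Word length of a group element with respect to a generating set `S`. -/
def wordLength [Group Γ] (S : Set Γ) (x : Γ) : ℕ :=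
  sInf {n : ℕ | ∃ l : List Γ, (∀ a ∈ l, a ∈ S) ∧ l.length = n ∧ l.prod = x}

/-- Word metric associated with a generating set `S`. -/
def wordDist [Group Γ] (S : Set Γ) (x y : Γ) : ℝ :=
  (wordLength S (x⁻¹ * y) : ℝ)

/-- `S` is a finite symmetric generating set. -/
def IsSymmGen [Group Γ] (S : Set Γ) : Prop :=
  S.Finite ∧ (∀ s ∈ S, s⁻¹ ∈ S) ∧ Subgroup.closure S = ⊤

/-- Gromov product of `x, y` based at `w` for the metric `d`. -/
def gromov (d : Γ → Γ → ℝ) (w x y : Γ) : ℝ := (d w x + d w y - d x y) / 2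

/-- `d` is a (genuine) metric on `Γ`. -/
structure IsMetric (d : Γ → Γ → ℝ) : Prop where
  refl : ∀ x, d x x = 0
  pos : ∀ x y, x ≠ y → 0 < d x y
  symm : ∀ x y, d x y = d y x
  triangle : ∀ x y z, d x z ≤ d x y + d y z

/-- `d` is `δ`-hyperbolic for some `δ ≥ 0` (Gromov product form). -/
def IsHyperbolicMetric (d : Γ → Γ → ℝ) : Prop :=
  ∃ δ : ℝ, 0 ≤ δ ∧ ∀ w x y z : Γ, min (gromov d w x z) (gromov d w z y) - δ ≤ gromov d w x y

/-- Two metrics are quasi-isometric. -/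
def QuasiIsometric (d₁ d₂ : Γ → Γ → ℝ) : Prop :=
  ∃ L C : ℝ, 0 < L ∧ 0 ≤ C ∧ ∀ x y : Γ,
    d₁ x y / L - C ≤ d₂ x y ∧ d₂ x y ≤ L * d₁ x y + C

/-- `d` belongs to `𝒟_Γ`: a left-invariant hyperbolic metric quasi-isometric to a
word metric. -/
structure InD [Group Γ] (d : Γ → Γ → ℝ) : Prop where
  metric : IsMetric d
  leftInv : ∀ g x y : Γ, d (g * x) (g * y) = d x y
  hyp : IsHyperbolicMetric d
  qi : ∃ S : Set Γ, IsSymmGen S ∧ QuasiIsometric (wordDist S) d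

/-- Strong hyperbolicity (Nica–Špakula / Mineyev). -/
def IsStronglyHyperbolic (d : Γ → Γ → ℝ) : Prop :=
  ∃ L s R₀ : ℝ, 0 ≤ L ∧ 0 < s ∧ 0 ≤ R₀ ∧
    ∀ (x x' y y' : Γ) (R : ℝ), R₀ ≤ R →
      R ≤ d x y - d x x' - d y y' + d x' y' →
      |d x y - d x' y - d x y' + d x' y'| ≤ L * Real.exp (-s * R)

/-- Exponential volume growth rate `gr(d)` of `(Γ, d)` based at the identity. -/
def growthRate [Group Γ] (d : Γ → Γ → ℝ) : ℝ :=
  limsup (fun n : ℕ => Real.log (Nat.card {x : Γ // d 1 x ≤ (n : ℝ)}) / (n : ℝ)) atTop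

/-- `Γ` is virtually cyclic. -/
def VirtuallyCyclic (Γ : Type*) [Group Γ] : Prop :=
  ∃ H : Subgroup Γ, H.FiniteIndex ∧ ∃ g : Γ, H = Subgroup.zpowers g

/-- `Γ` is a non-elementary hyperbolic group: some (equivalently, any) word metric is
hyperbolic and `Γ` is not virtually cyclic. -/
def NonElemHyperbolic (Γ : Type*) [Group Γ] : Prop :=
  (∃ S : Set Γ, IsSymmGen S ∧ IsHyperbolicMetric (wordDist S)) ∧ ¬ VirtuallyCyclic Γ

/-! ## Mean distortion -/

/-- Cardinality of the word sphere `𝐒_n`. -/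
def sphCard [Group Γ] (S : Set Γ) (n : ℕ) : ℕ :=
  Nat.card {x : Γ // wordLength S x = n}

/-- Average `S⋆`-word length over the `S`-sphere of radius `n`. -/
def meanLen [Group Γ] (S Sst : Set Γ) (n : ℕ) : ℝ :=
  (∑' x : {x : Γ // wordLength S x = n}, (wordLength Sst (x : Γ) : ℝ)) / (sphCard S n : ℝ)

/-- Mean distortion `τ(S⋆/S)`. -/
def meanDistortion [Group Γ] (S Sst : Set Γ) : ℝ :=
  liminf (fun n : ℕ => meanLen S Sst n / (n : ℝ)) atTop

/-! ## Hausdorff measures and dimension with respect to a gauge -/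

/-- Diameter of a set with respect to a gauge `ρ`. -/
def gdiam {X : Type*} (ρ : X → X → ℝ) (E : Set X) : ℝ≥0∞ :=
  ⨆ x ∈ E, ⨆ y ∈ E, ENNReal.ofReal (ρ x y)

/-- Pre-Hausdorff content at scale `Δ`. -/
def hMeasAux {X : Type*} (ρ : X → X → ℝ) (D : ℝ) (Δ : ℝ≥0∞) (E : Set X) : ℝ≥0∞ :=
  ⨅ (c : ℕ → Set X) (_ : E ⊆ ⋃ n, c n) (_ : ∀ n, gdiam ρ (c n) ≤ Δ),
    ∑' n, gdiam ρ (c n) ^ D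

/-- `D`-dimensional Hausdorff measure of a set relative to the gauge `ρ`. -/
def hMeas {X : Type*} (ρ : X → X → ℝ) (D : ℝ) (E : Set X) : ℝ≥0∞ :=
  ⨆ (Δ : ℝ≥0∞) (_ : 0 < Δ), hMeasAux ρ D Δ E

/-- Hausdorff dimension of a set relative to the gauge `ρ`. -/
def hDim {X : Type*} (ρ : X → X → ℝ) (E : Set X) : ℝ :=
  sSup {D : ℝ | 0 ≤ D ∧ hMeas ρ D E ≠ 0}

/-- Lower Hausdorff dimension of a measure. -/
def lowerHDim {X : Type*} [MeasurableSpace X] (ρ : X → X → ℝ) (ν : Measure X) : ℝ :=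
  sInf {r : ℝ | ∃ E : Set X, MeasurableSet E ∧ 0 < ν E ∧ hDim ρ E = r}

/-- Upper Hausdorff dimension of a measure. -/
def upperHDim {X : Type*} [MeasurableSpace X] (ρ : X → X → ℝ) (ν : Measure X) : ℝ :=
  sInf {r : ℝ | ∃ E : Set X, MeasurableSet E ∧ ν Eᶜ = 0 ∧ hDim ρ E = r}

/-- Radon measure: finite on compacts and outer regular. -/
def IsRadon {X : Type*} [TopologicalSpace X] [MeasurableSpace X] (ν : Measure X) : Prop :=
  (∀ K : Set X, IsCompact K → ν K < ⊤) ∧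
  (∀ A : Set X, MeasurableSet A → ν A = ⨅ (U : Set X) (_ : IsOpen U) (_ : A ⊆ U), ν U)

/-! ## Abstract boundary data for a hyperbolic metric on `Γ` -/

/-- The Gromov boundary of `(Γ, d)` packaged abstractly: a compact space `B` with a
continuous `Γ`-action, the extension of the Gromov product (based at the identity `o`)
to pairs of boundary points (`gpb`) and to a group element and a boundary point (`gpx`),
satisfying hyperbolicity, the characteristic identities of Busemann functions and the
expected continuity properties. -/
structure BoundaryData (Γ : Type*) [Group Γ] (d : Γ → Γ → ℝ)
    (B : Type*) [TopologicalSpace B] where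
  act : Γ → B → B
  act_one : ∀ ξ : B, act 1 ξ = ξ
  act_mul : ∀ (x y : Γ) (ξ : B), act (x * y) ξ = act x (act y ξ)
  act_cont : ∀ x : Γ, Continuous (act x)
  gpb : B → B → ℝ
  gpx : Γ → B → ℝ
  gpb_symm : ∀ ξ η : B, gpb ξ η = gpb η ξ
  gpb_nonneg : ∀ ξ η : B, 0 ≤ gpb ξ η
  gpx_nonneg : ∀ (x : Γ) (ξ : B), 0 ≤ gpx x ξ
  gpb_cont : ContinuousOn (fun p : B × B => gpb p.1 p.2) {p : B × B | p.1 ≠ p.2}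
  gpx_cont : ∀ x : Γ, Continuous (gpx x)
  hyp : ∃ δ : ℝ, 0 ≤ δ ∧
    (∀ ξ η ζ : B, min (gpb ξ ζ) (gpb ζ η) - δ ≤ gpb ξ η) ∧
    (∀ (x : Γ) (ξ η : B), min (gpx x ξ) (gpb ξ η) - δ ≤ gpx x η) ∧
    (∀ (x y : Γ) (ξ : B), min (gromov d 1 x y) (gpx y ξ) - δ ≤ gpx x ξ)
  at_infinity : ∀ (ξ : B) (M : ℝ), ∃ x : Γ, M ≤ gpx x ξ
  conformal : ∃ C : ℝ, 0 ≤ C ∧ ∀ (x : Γ) (ξ η : B), ξ ≠ η →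
    |((d 1 x - 2 * gpx x ξ) + (d 1 x - 2 * gpx x η))
        - (2 * gpb (act x⁻¹ ξ) (act x⁻¹ η) - 2 * gpb ξ η)| ≤ C

variable {B : Type*}

/-- The boundary square `∂²Γ`: pairs of distinct boundary points. -/
abbrev B2 (B : Type*) := {p : B × B // p.1 ≠ p.2}

/-- Busemann cocycle for a strongly hyperbolic metric:
`b_o(x, ξ) = d(o, x) - 2⟨x|ξ⟩_o`. -/
def busemann [Group Γ] {d : Γ → Γ → ℝ} [TopologicalSpace B]
    (bd : BoundaryData Γ d B) (x : Γ) (ξ : B) : ℝ :=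
  d 1 x - 2 * bd.gpx x ξ

/-- Busemann function of a general metric `d ∈ 𝒟_Γ`:
`b_o(x, ξ) = sup { limsup_n (d(x, z_n) - d(o, z_n)) : z_n → ξ }`. -/
def busemannSup [Group Γ] {d : Γ → Γ → ℝ} [TopologicalSpace B]
    (bd : BoundaryData Γ d B) (x : Γ) (ξ : B) : ℝ :=
  sSup {t : ℝ | ∃ z : ℕ → Γ,
    Tendsto (fun n => bd.gpx (z n) ξ) atTop atTop ∧
    t = limsup (fun n => d x (z n) - d 1 (z n)) atTop}

open Classical in
/-- The gauge `ρ(ξ, η) = exp(-(ξ|η)_o)` on the boundary. -/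
def gaugeB [Group Γ] {d : Γ → Γ → ℝ} [TopologicalSpace B]
    (bd : BoundaryData Γ d B) (ξ η : B) : ℝ :=
  if ξ = η then 0 else Real.exp (-(bd.gpb ξ η))

/-- The max-gauge `ρ_×` on the boundary square. -/
def gaugeX [Group Γ] {d : Γ → Γ → ℝ} [TopologicalSpace B]
    (bd : BoundaryData Γ d B) (p q : B2 B) : ℝ :=
  max (gaugeB bd p.1.1 q.1.1) (gaugeB bd p.1.2 q.1.2)

/-- Diagonal action of `Γ` on the boundary square. -/
def BoundaryData.dact [Group Γ] {d : Γ → Γ → ℝ} [TopologicalSpace B]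
    (bd : BoundaryData Γ d B) (g : Γ) (p : B2 B) : B2 B :=
  ⟨(bd.act g p.1.1, bd.act g p.1.2), fun h => p.2 (by
    have h' : bd.act g p.1.1 = bd.act g p.1.2 := h
    have h2 : ∀ ξ : B, bd.act g⁻¹ (bd.act g ξ) = ξ := fun ξ => by
      rw [← bd.act_mul, inv_mul_cancel, bd.act_one]
    have h3 := congrArg (bd.act g⁻¹) h'
    rwa [h2, h2] at h3)⟩

/-- Patterson–Sullivan property: quasi-conformal density of dimension `gr(d)` with
respect to the Busemann function `bus`. -/
def IsPS [Group Γ] [TopologicalSpace B] [MeasurableSpace B] {d : Γ → Γ → ℝ}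
    (bd : BoundaryData Γ d B) (bus : Γ → B → ℝ) (μ : Measure B) : Prop :=
  IsProbabilityMeasure μ ∧ ∃ C : ℝ, 1 ≤ C ∧ ∀ x : Γ,
    Measure.map (bd.act x) μ
        ≤ μ.withDensity (fun ξ => ENNReal.ofReal (C * Real.exp (-(growthRate d) * bus x ξ))) ∧
    μ.withDensity (fun ξ => ENNReal.ofReal (C⁻¹ * Real.exp (-(growthRate d) * bus x ξ)))
        ≤ Measure.map (bd.act x) μ

/-- Product measure on the boundary square (restriction of `μ ⊗ ν` off the diagonal). -/
def prodB2 [TopologicalSpace B] [MeasurableSpace B] (μ ν : Measure B) : Measure (B2 B) :=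
  Measure.comap Subtype.val (μ.prod ν)

/-- The Bowen–Margulis current `exp(2·gr(d)·⟨ξ|η⟩_o)·(μ ⊗ μ)` on `∂²Γ`. -/
def bmCurrent [Group Γ] [TopologicalSpace B] [MeasurableSpace B] {d : Γ → Γ → ℝ}
    (bd : BoundaryData Γ d B) (μ : Measure B) : Measure (B2 B) :=
  (prodB2 μ μ).withDensity
    (fun p => ENNReal.ofReal (Real.exp (2 * growthRate d * bd.gpb p.1.1 p.1.2)))

/-! ## The topological flow space -/

/-- The cocycle `α(x, ξ, η) = (b_o(x⁻¹, ξ) - b_o(x⁻¹, η))/2`. -/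
def alphaC [Group Γ] [TopologicalSpace B] {d : Γ → Γ → ℝ}
    (bd : BoundaryData Γ d B) (x : Γ) (p : B2 B) : ℝ :=
  (busemann bd x⁻¹ p.1.1 - busemann bd x⁻¹ p.1.2) / 2

/-- The `(Γ, α)`-action on `∂²Γ × ℝ`:
`x·(ξ, η, t) = (xξ, xη, t - α(x, ξ, η))`. -/
def gact [Group Γ] [TopologicalSpace B] {d : Γ → Γ → ℝ}
    (bd : BoundaryData Γ d B) (x : Γ) : B2 B × ℝ → B2 B × ℝ :=
  fun q => (bd.dact x q.1, q.2 - alphaC bd x q.1)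

/-- Orbit relation of the `(Γ, α)`-action. -/
def orbitRel [Group Γ] [TopologicalSpace B] {d : Γ → Γ → ℝ}
    (bd : BoundaryData Γ d B) : (B2 B × ℝ) → (B2 B × ℝ) → Prop :=
  fun p q => ∃ x : Γ, gact bd x p = q

/-- The topological flow space `ℱ_α = Γ \ (∂²Γ × ℝ)`. -/
abbrev FlowSpace [Group Γ] [TopologicalSpace B] {d : Γ → Γ → ℝ}
    (bd : BoundaryData Γ d B) :=
  Quot (orbitRel bd)

/-- The topological flow `Φ_t` on `ℱ_α` induced by translation in the `ℝ`-coordinate. -/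
def flowQ [Group Γ] [TopologicalSpace B] {d : Γ → Γ → ℝ}
    (bd : BoundaryData Γ d B) (t : ℝ) : FlowSpace bd → FlowSpace bd :=
  Quot.map (fun p => (p.1, p.2 + t)) (by
    rintro p q ⟨x, rfl⟩
    refine ⟨x, ?_⟩
    have h4 : p.2 + t - alphaC bd x p.1 = p.2 - alphaC bd x p.1 + t := by ring
    exact congrArg (Prod.mk (bd.dact x p.1)) h4)

/-- Representative of a point of a quotient. -/
def qout {α : Type*} {r : α → α → Prop} (q : Quot r) : α :=
  (Quot.exists_rep q).choose

/-! ## Automatic structures and symbolic dynamics -/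

/-- A finite labelled directed graph (automaton) over the alphabet `S ⊆ Γ`. -/
structure Automaton (Γ : Type*) (S : Set Γ) where
  V : Type
  E : Type
  fintypeV : Fintype V
  fintypeE : Fintype E
  src : E → V
  tgt : E → V
  init : V
  lab : E → Γ
  lab_mem : ∀ e, lab e ∈ S

attribute [instance] Automaton.fintypeV Automaton.fintypeE

namespace Automaton

variable {S : Set Γ}

/-- A list of edges is a directed path. -/
def Chain (A : Automaton Γ S) : List A.E → Prop
  | [] => True
  | [_] => True
  | e :: e' :: l => A.tgt e = A.src e' ∧ Chain A (e' :: l)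

/-- A path starts at the initial state. -/
def FromInit (A : Automaton Γ S) (l : List A.E) : Prop :=
  ∀ h : l ≠ [], A.src (l.head h) = A.init

/-- The group element labelled by a path. -/
def pathProd [Group Γ] (A : Automaton Γ S) (l : List A.E) : Γ :=
  (l.map A.lab).prod

/-- A path stays in the set of vertices `W`. -/
def ChainIn (A : Automaton Γ S) (W : Set A.V) (l : List A.E) : Prop :=
  A.Chain l ∧ ∀ e ∈ l, A.src e ∈ W ∧ A.tgt e ∈ W

/-- `w` can be reached from `v` by a directed path inside `W`. -/
def Reaches (A : Automaton Γ S) (W : Set A.V) (v w : A.V) : Prop :=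
  v = w ∨ ∃ (l : List A.E) (h : l ≠ []), A.ChainIn W l ∧
    A.src (l.head h) = v ∧ A.tgt (l.getLast h) = w

/-- The subgraph on `W` is recurrent. -/
def IsRecurrentOn (A : Automaton Γ S) (W : Set A.V) : Prop :=
  ∀ v ∈ W, ∀ w ∈ W, A.Reaches W v w

/-- A component: a maximal recurrent subgraph. -/
def IsComponent (A : Automaton Γ S) (W : Set A.V) : Prop :=
  W.Nonempty ∧ A.IsRecurrentOn W ∧
    ∀ W' : Set A.V, W ⊆ W' → A.IsRecurrentOn W' → W' = W

end Automaton

/-- A strongly Markov automatic structure (Cannon): all vertices are reachable from the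
initial state, paths label geodesics in the Cayley graph, and evaluation is a bijection
from directed paths from the initial state onto `Γ`. -/
structure IsStronglyMarkov [Group Γ] {S : Set Γ} (A : Automaton Γ S) : Prop where
  reach : ∀ v : A.V, ∃ l : List A.E, A.Chain l ∧ A.FromInit l ∧
    ((l = [] ∧ v = A.init) ∨ ∃ h : l ≠ [], A.tgt (l.getLast h) = v)
  geodesic : ∀ l : List A.E, A.Chain l → wordLength S (A.pathProd l) = l.length
  endpoint_bij : Function.Bijective
    (fun l : {l : List A.E // A.Chain l ∧ A.FromInit l} => A.pathProd l.1)

instance {S : Set Γ} (A : Automaton Γ S) : MeasurableSpace A.E := ⊤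
instance {S : Set Γ} (A : Automaton Γ S) : TopologicalSpace A.E := ⊥

/-- The two-sided subshift of finite type of bi-infinite directed paths in `A`. -/
abbrev BiPath {S : Set Γ} (A : Automaton Γ S) :=
  {ω : ℤ → A.E // ∀ i : ℤ, A.tgt (ω i) = A.src (ω (i + 1))}

/-- The shift `σ` on bi-infinite paths. -/
def shiftB {S : Set Γ} (A : Automaton Γ S) (ω : BiPath A) : BiPath A :=
  ⟨fun i => ω.1 (i + 1), fun i => ω.2 (i + 1)⟩

open Classical in
/-- The metric `d_Σ(ω, ω') = e^{-n}`, `n = sup{k : ω_i = ω'_i for |i| ≤ k}`. -/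
def dSigma {S : Set Γ} {A : Automaton Γ S} (ω ω' : BiPath A) : ℝ :=
  if ω = ω' then 0
  else Real.exp (-((sSup {k : ℕ | ∀ i : ℤ, |i| ≤ (k : ℤ) → ω.1 i = ω'.1 i} : ℕ) : ℝ))

/-- Partial products along the positive ray of a bi-infinite path. -/
def rayPos [Group Γ] {S : Set Γ} (A : Automaton Γ S) (ω : BiPath A) (n : ℕ) : Γ :=
  ((List.range n).map fun i => A.lab (ω.1 (i : ℤ))).prod

/-- Partial products along the negative ray of a bi-infinite path. -/
def rayNeg [Group Γ] {S : Set Γ} (A : Automaton Γ S) (ω : BiPath A) (n : ℕ) : Γ :=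
  ((List.range n).map fun i => (A.lab (ω.1 (-(i : ℤ) - 1)))⁻¹).prod

/-- `wst` is the endpoint map `w_* : Σ → ∂²Γ`: the two labelled geodesic rays of a
bi-infinite path converge to the two components of `wst ω` (convergence to a boundary
point being expressed by divergence of the Gromov product). -/
def IsEndpointMap [Group Γ] {S : Set Γ} (A : Automaton Γ S) [TopologicalSpace B]
    {d : Γ → Γ → ℝ} (bd : BoundaryData Γ d B) (wst : BiPath A → B2 B) : Prop :=
  ∀ ω : BiPath A,
    Tendsto (fun n : ℕ => bd.gpx (rayNeg A ω n) (wst ω).1.1) atTop atTop ∧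
    Tendsto (fun n : ℕ => bd.gpx (rayPos A ω n) (wst ω).1.2) atTop atTop

/-- The function `α̃(ω) = α(w(ω₀)⁻¹, w_*(ω))` on the shift space. -/
def alphaTilde [Group Γ] {S : Set Γ} (A : Automaton Γ S) [TopologicalSpace B]
    {d : Γ → Γ → ℝ} (bd : BoundaryData Γ d B) (wst : BiPath A → B2 B)
    (ω : BiPath A) : ℝ :=
  alphaC bd (A.lab (ω.1 0))⁻¹ (wst ω)

/-- Birkhoff sums on the two-sided shift. -/
def birkhoffB {S : Set Γ} (A : Automaton Γ S) (f : BiPath A → ℝ) (N : ℕ)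
    (ω : BiPath A) : ℝ :=
  ∑ i ∈ Finset.range N, f ((shiftB A)^[i] ω)

/-- The identification generating the suspension flow:
`(ω, t + r(ω)) ∼ (σ^N ω, t)`. -/
def susRel {S : Set Γ} (A : Automaton Γ S) (r : BiPath A → ℝ) (N : ℕ) :
    (BiPath A × ℝ) → (BiPath A × ℝ) → Prop :=
  fun p q => q.1 = (shiftB A)^[N] p.1 ∧ q.2 = p.2 - r p.1

/-- The suspension space `Sus(Σ, r)`. -/
abbrev Sus {S : Set Γ} (A : Automaton Γ S) (r : BiPath A → ℝ) (N : ℕ) :=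
  Quot (susRel A r N)

/-- The suspension flow `σ_t [ω, s] = [ω, s + t]`. -/
def susFlow {S : Set Γ} (A : Automaton Γ S) (r : BiPath A → ℝ) (N : ℕ) (t : ℝ) :
    Sus A r N → Sus A r N :=
  Quot.map (fun p => (p.1, p.2 + t)) (by
    rintro p q ⟨h1, h2⟩
    have h3 : q.2 + t = (p.2 + t) - r p.1 := by rw [h2]; ring
    exact ⟨h1, h3⟩)

/-- The set `Σ_𝒞` of bi-infinite paths staying in the component `W` for all time. -/
def SigmaC {S : Set Γ} (A : Automaton Γ S) (W : Set A.V) : Set (BiPath A) :=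
  {ω | ∀ i : ℤ, A.src (ω.1 i) ∈ W}

/-- The cylinder in `Σ_𝒞` determined by a finite word. -/
def cylSet {S : Set Γ} (A : Automaton Γ S) (W : Set A.V) (n : ℕ)
    (w : Fin n → A.E) : Set (BiPath A) :=
  {ω | ω ∈ SigmaC A W ∧ ∀ i : Fin n, ω.1 ((i : ℕ) : ℤ) = w i}

/-- The cylinder of length `n` of a given bi-infinite path (coordinates `0, …, n-1`). -/
def cylPos {S : Set Γ} (A : Automaton Γ S) (n : ℕ) (ω : BiPath A) :
    Set (BiPath A) :=
  {ω' | ∀ i : ℕ, i < n → ω'.1 (i : ℤ) = ω.1 (i : ℤ)}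

/-- The pressure of a potential on the component `W` of the two-sided shift, via
partition sums over cylinders. -/
def prC {S : Set Γ} (A : Automaton Γ S) (W : Set A.V) (ψ : BiPath A → ℝ) : ℝ :=
  limsup (fun n : ℕ =>
    Real.log (∑' w : {w : Fin n → A.E // (cylSet A W n w).Nonempty},
      Real.exp (sSup (birkhoffB A ψ n '' cylSet A W n w.1))) / (n : ℝ)) atTop

/-- Birkhoff sums of a potential on finite unilateral paths. -/
def finBirk {S : Set Γ} (A : Automaton Γ S) (φ : List A.E → ℝ) (l : List A.E) : ℝ :=
  ∑ k ∈ Finset.range l.length, φ (l.drop k)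

/-- The pressure (logarithm of the maximal modulus of the eigenvalues of the transfer
operator `ℒ_φ` restricted to the component `W`), expressed through the partition sums
over finite paths staying in `W`. -/
def prCfin {S : Set Γ} (A : Automaton Γ S) (W : Set A.V) (φ : List A.E → ℝ) : ℝ :=
  limsup (fun n : ℕ =>
    Real.log (∑' l : {l : List A.E // A.ChainIn W l ∧ l.length = n},
      Real.exp (finBirk A φ l.1)) / (n : ℝ)) atTop

/-- The potential `b̃` on finite unilateral paths:
`b̃(ω) = b̂_o(w(ω₀), w_* ω) = d(w(ω₀), w_* ω) - d(o, w_* ω)`. -/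
def potB [Group Γ] {S : Set Γ} (A : Automaton Γ S) (d : Γ → Γ → ℝ) :
    List A.E → ℝ
  | [] => 0
  | e :: l' => d (A.lab e) (A.pathProd (e :: l')) - d 1 (A.pathProd (e :: l'))

/-! ## Kolmogorov–Sinai entropy -/

/-- A finite measurable partition. -/
def IsFinPartition {X : Type*} [MeasurableSpace X] {k : ℕ} (P : Fin k → Set X) : Prop :=
  (∀ i, MeasurableSet (P i)) ∧ Pairwise (Function.onFun Disjoint P) ∧
    (⋃ i, P i) = Set.univ

/-- Entropy of a finite partition. -/
def partEnt {X : Type*} [MeasurableSpace X] {ι : Type*} [Fintype ι]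
    (ν : Measure X) (P : ι → Set X) : ℝ :=
  -∑ i, ((ν (P i)).toReal * Real.log (ν (P i)).toReal)

/-- The join `⋁_{i<n} T^{-i} P`. -/
def joinPart {X : Type*} (T : X → X) {k : ℕ} (P : Fin k → Set X) (n : ℕ)
    (f : Fin n → Fin k) : Set X :=
  ⋂ i : Fin n, T^[(i : ℕ)] ⁻¹' P (f i)

/-- Kolmogorov–Sinai (measure-theoretic) entropy of `T` with respect to `ν`. -/
def ksEntropy {X : Type*} [MeasurableSpace X] (T : X → X) (ν : Measure X) : ℝ :=
  sSup {h : ℝ | ∃ (k : ℕ) (P : Fin k → Set X), IsFinPartition P ∧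
    h = liminf (fun n : ℕ => partEnt ν (joinPart T P n) / (n : ℝ)) atTop}

end HypFlow

end

namespace HypFlow


/-- The four-point form of `δ`-hyperbolicity. -/
def FourPoint {X : Type*} (d : X → X → ℝ) (δ : ℝ) : Prop :=
  ∀ x y z w, d x y + d z w ≤ max (d x z + d y w) (d x w + d y z) + 2 * δ

theorem IsMetric.nonneg {X : Type*} {d : X → X → ℝ} (hd : IsMetric d) (x y : X) : 0 ≤ d x y := by
  have h1 := hd.triangle x y x
  rw [hd.refl, hd.symm y x] at h1
  linarith

theorem fourPoint_of_gromov {X : Type*} {d : X → X → ℝ} (hd : IsMetric d) {δ : ℝ}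
    (h : ∀ w x y z : X, min (gromov d w x z) (gromov d w z y) - δ ≤ gromov d w x y) :
    FourPoint d δ := by
  intro x y z w
  have h1 := h x z w y
  have e1 := hd.symm z y
  unfold gromov at h1
  rcases min_cases ((d x z + d x y - d z y) / 2) ((d x y + d x w - d y w) / 2) with ⟨h2, _⟩ | ⟨h2, _⟩
  · have := le_max_right (d x z + d y w) (d x w + d y z)
    linarith
  · have := le_max_left (d x z + d y w) (d x w + d y z)
    linarith

/-- The distance from `z` to an ideal point lying on a segment from `x` to `y`
at distance `t` from `x`. -/
def idealDist {X : Type*} (d : X → X → ℝ) (x y : X) (t : ℝ) (z : X) : ℝ :=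
  max (d x z - t) (d y z - (d x y - t))

section IdealPoint

variable {X : Type*} {d : X → X → ℝ} {δ : ℝ}

theorem idealDist_fourPoint (hδ : FourPoint d δ) (x y : X) (t : ℝ) (z u w : X) :
    idealDist d x y t w + d z u ≤
      max (idealDist d x y t z + d w u) (idealDist d x y t u + d w z) + 2 * δ := by
  have hx := hδ x w z u
  have hy := hδ y w z u
  unfold idealDist
  grind

theorem dist_le_idealDist_add (hd : IsMetric d) (hδ : FourPoint d δ) (x y : X) (t : ℝ) (z w : X) :
    d z w ≤ idealDist d x y t z + idealDist d x y t w + 2 * δ := by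
  have hx := hδ x y z w
  have := hd.symm x y
  unfold idealDist
  grind

theorem idealDist_left (hd : IsMetric d) {x y : X} {t : ℝ} (ht : 0 ≤ t) :
    idealDist d x y t x = t := by
  unfold idealDist
  have := hd.symm x y
  have := hd.refl x
  grind

theorem idealDist_right (hd : IsMetric d) {x y : X} {t : ℝ} (ht : t ≤ d x y) :
    idealDist d x y t y = d x y - t := by
  unfold idealDist
  have := hd.refl y
  grind

theorem idealDist_le_add_abs (x y : X) (t t' : ℝ) (z : X) :
    idealDist d x y t z ≤ idealDist d x y t' z + |t - t'| := by
  unfold idealDist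
  grind

theorem idealDist_le_add_dist (hd : IsMetric d) (x y : X) (t : ℝ) (z w : X) :
    idealDist d x y t z ≤ idealDist d x y t w + d w z := by
  unfold idealDist
  have := hd.triangle x w z
  have := hd.triangle y w z
  grind

/-- Distances to a point seen from outside, along a path staying far from that point. -/
theorem chain_gromov {f : X → ℝ}
    (hf : ∀ z u w, f w + d z u ≤ max (f z + d w u) (f u + d w z) + 2 * δ)
    (hd : IsMetric d) {p : ℕ → X} {M s : ℝ} (hs : 0 ≤ s) (k : ℕ) :
    ∀ a b : ℕ, a ≤ b → b - a ≤ 2 ^ k → (∀ i, a ≤ i → i ≤ b → M ≤ f (p i)) →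
      (∀ i, a ≤ i → i < b → d (p i) (p (i + 1)) ≤ s) →
      2 * M - s - 2 * (k * δ) ≤ f (p a) + f (p b) - d (p a) (p b) := by
  induction k with
  | zero =>
    intro a b hab hk hM hst
    have h1 := hM a le_rfl hab
    have h2 := hM b hab le_rfl
    rcases hab.eq_or_lt with rfl | hlt
    · rw [hd.refl]; push_cast; linarith
    · obtain rfl : b = a + 1 := by simp at hk; omega
      have := hst a le_rfl hlt
      push_cast; linarith
  | succ k ih =>
    intro a b hab hk hM hst
    rw [pow_succ] at hk
    have h1 := ih a ((a + b) / 2) (by omega) (by omega) (fun i h h' => hM i h (by omega))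
      (fun i h h' => hst i h (by omega))
    have h2 := ih ((a + b) / 2) b (by omega) (by omega) (fun i h h' => hM i (by omega) h')
      (fun i h h' => hst i (by omega) h')
    have h3 := hf (p a) (p b) (p ((a + b) / 2))
    have e := hd.symm (p a) (p ((a + b) / 2))
    push_cast
    rcases le_max_iff.1 (le_refl (max (f (p a) + d (p ((a + b) / 2)) (p b))
      (f (p b) + d (p ((a + b) / 2)) (p a)))) with h | h <;> linarith

/-- A sequence is an `(L, C)`-quasi-geodesic on `{0, …, N}`. -/
def QuasiGeod (d : X → X → ℝ) (L C : ℝ) (p : ℕ → X) (N : ℕ) : Prop :=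
  ∀ i j, i ≤ j → j ≤ N →
    d (p i) (p j) ≤ L * ((j : ℝ) - i) + C ∧ (j : ℝ) - i ≤ L * d (p i) (p j) + C

theorem exists_morse_threshold (hδ0 : 0 ≤ δ) (a b c : ℝ) (ha : 0 ≤ a) :
    ∃ B₀ : ℝ, 0 ≤ B₀ ∧ ∀ B, B₀ ≤ B → ∃ k : ℕ, a * B + b ≤ 2 ^ k ∧ c + δ * (k + 2) < B := by
  have hlim : Tendsto (fun k : ℕ => ((k : ℝ) ^ 1 / 2 ^ k)) atTop (𝓝 0) :=
    tendsto_pow_const_div_const_pow_of_one_lt 1 (by norm_num)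
  set q : ℝ := 2 * (δ + 1) with hq
  have hq0 : 0 < q := by positivity
  set m : ℝ := a * q + (a * q + |b|) with hm
  have hm0 : 0 ≤ m := by positivity
  have h1 : ∀ᶠ k : ℕ in atTop, (k : ℝ) ^ 1 / 2 ^ k < 1 / (m + 1) :=
    hlim.eventually_lt_const (by positivity)
  obtain ⟨k₀, hk₀⟩ := eventually_atTop.1 h1
  refine ⟨max (q * (k₀ + 1)) (2 * (|c| + 2 * δ + 1)), by positivity, fun B hB => ?_⟩
  have hB1 := (le_max_left _ _).trans hB
  have hB2 := (le_max_right _ _).trans hB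
  have hB0 : 0 ≤ B := le_trans (by positivity) hB1
  refine ⟨⌊B / q⌋₊, ?_, ?_⟩
  · set k := ⌊B / q⌋₊ with hk
    have hk1 : k₀ + 1 ≤ k := by
      apply Nat.le_floor
      rw [le_div_iff₀ hq0]; push_cast; linarith
    have h2 := hk₀ k (by omega)
    have hBk : B < q * (k + 1) := by
      have := Nat.lt_floor_add_one (B / q)
      rw [div_lt_iff₀ hq0] at this
      linarith
    have hkr : (1 : ℝ) ≤ k := by exact_mod_cast (by omega : 1 ≤ k)
    rw [pow_one, div_lt_div_iff₀ (by positivity) (by positivity)] at h2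
    have h3 : a * B ≤ a * (q * (k + 1)) := mul_le_mul_of_nonneg_left hBk.le ha
    have h4 : b ≤ |b| * k := by
      have := le_abs_self b
      nlinarith [abs_nonneg b]
    have h5 : a * q * 1 ≤ a * q * k := mul_le_mul_of_nonneg_left hkr (by positivity)
    nlinarith
  · have h1 : (⌊B / q⌋₊ : ℝ) ≤ B / q := Nat.floor_le (by positivity)
    have h2 : δ * (⌊B / q⌋₊ : ℝ) ≤ B / 2 := by
      calc δ * (⌊B / q⌋₊ : ℝ) ≤ (δ + 1) * (B / q) := by gcongr; linarith
        _ = B / 2 := by rw [hq]; field_simp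
    have := le_abs_self c
    nlinarith

/-- Every ideal point of a segment is close to a quasi-geodesic with the same endpoints. -/
theorem exists_near_quasiGeod (hd : IsMetric d) (hδ0 : 0 ≤ δ) (hδ : FourPoint d δ) {L C : ℝ}
    (hL : 0 ≤ L) (hC : 0 ≤ C) :
    ∃ B₀ : ℝ, 0 ≤ B₀ ∧ ∀ (p : ℕ → X) (N : ℕ), QuasiGeod d L C p N →
      ∀ t, 0 ≤ t → t ≤ d (p 0) (p N) → ∃ i, i ≤ N ∧ idealDist d (p 0) (p N) t (p i) ≤ B₀ := by
  obtain ⟨B₀, hB₀, hB⟩ := exists_morse_threshold hδ0 (L * 6) (L * (2 * δ) + C) (1 + (L + C) / 2)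
    (by positivity)
  refine ⟨B₀, hB₀, fun p N hp => ?_⟩
  set ℓ := d (p 0) (p N) with hℓ
  have hℓ0 : 0 ≤ ℓ := hd.nonneg _ _
  set D := idealDist d (p 0) (p N) with hD
  have descent : ∀ B, B₀ ≤ B → (∀ t, 0 ≤ t → t ≤ ℓ → ∃ i, i ≤ N ∧ D t (p i) ≤ B) →
      ∀ t, 0 ≤ t → t ≤ ℓ → ∃ i, i ≤ N ∧ D t (p i) ≤ B - 1 := by
    intro B hBB hQ t ht0 htl
    by_contra! hfar
    obtain ⟨k, hk1, hk2⟩ := hB B hBB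
    have hB0 : 0 ≤ B := hB₀.trans hBB
    have hDx : D t (p 0) = t := idealDist_left hd ht0
    have hDy : D t (p N) = ℓ - t := idealDist_right hd htl
    have hleft : ∃ a, a ≤ N ∧ 2 * (B - 1) ≤ D t (p a) + D t (p 0) - d (p a) (p 0) ∧
        D t (p a) ≤ 3 * B := by
      rcases le_total (2 * B) t with h | h
      · obtain ⟨a, haN, ha⟩ := hQ (t - 2 * B) (by linarith) (by linarith)
        refine ⟨a, haN, ?_, ?_⟩
        · have h1 : d (p 0) (p a) - (t - 2 * B) ≤ D (t - 2 * B) (p a) := le_max_left _ _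
          have h2 := hfar a haN
          have := hd.symm (p a) (p 0)
          linarith
        · have := idealDist_le_add_abs (d := d) (p 0) (p N) t (t - 2 * B) (p a)
          rw [show t - (t - 2 * B) = 2 * B by ring, abs_of_nonneg (by positivity)] at this
          linarith
      · have := hfar 0 (Nat.zero_le _)
        refine ⟨0, Nat.zero_le _, ?_, by linarith⟩
        rw [hd.refl]
        linarith
    have hright : ∃ b, b ≤ N ∧ 2 * (B - 1) ≤ D t (p b) + D t (p N) - d (p b) (p N) ∧
        D t (p b) ≤ 3 * B := by
      rcases le_total (2 * B) (ℓ - t) with h | h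
      · obtain ⟨b, hbN, hb⟩ := hQ (t + 2 * B) (by linarith) (by linarith)
        refine ⟨b, hbN, ?_, ?_⟩
        · have h1 : d (p N) (p b) - (ℓ - (t + 2 * B)) ≤ D (t + 2 * B) (p b) := le_max_right _ _
          have h2 := hfar b hbN
          have := hd.symm (p b) (p N)
          linarith
        · have := idealDist_le_add_abs (d := d) (p 0) (p N) t (t + 2 * B) (p b)
          rw [show t - (t + 2 * B) = -(2 * B) by ring, abs_neg,
            abs_of_nonneg (by positivity)] at this
          linarith
      · have := hfar N le_rfl
        refine ⟨N, le_rfl, ?_, by linarith⟩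
        rw [hd.refl]
        linarith
    obtain ⟨a, haN, ha, ha'⟩ := hleft
    obtain ⟨b, hbN, hb, hb'⟩ := hright
    have hmid : ∀ i j, i ≤ j → j ≤ N → d (p i) (p j) ≤ 6 * B + 2 * δ →
        2 * (B - 1) - (L + C) - 2 * (k * δ) ≤ D t (p i) + D t (p j) - d (p i) (p j) := by
      intro i j hij hjN hdij
      apply chain_gromov (fun z u w => idealDist_fourPoint hδ (p 0) (p N) t z u w) hd
        (add_nonneg hL hC) k i j hij
      · have h1 := (hp i j hij hjN).2
        have h2 : L * d (p i) (p j) ≤ L * (6 * B + 2 * δ) := mul_le_mul_of_nonneg_left hdij hL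
        have h3 : ((j - i : ℕ) : ℝ) ≤ ((2 ^ k : ℕ) : ℝ) := by
          rw [Nat.cast_sub hij]; push_cast; linarith
        exact_mod_cast h3
      · intro i' _ h'
        exact (hfar i' (by omega)).le
      · intro i' _ h'
        have := (hp i' (i' + 1) (by omega) (by omega)).1
        push_cast at this
        linarith
    have hdab : d (p a) (p b) ≤ 6 * B + 2 * δ := by
      have := dist_le_idealDist_add hd hδ (p 0) (p N) t (p a) (p b)
      linarith
    have hab : 2 * (B - 1) - (L + C) - 2 * (k * δ) ≤ D t (p a) + D t (p b) - d (p a) (p b) := by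
      rcases le_total a b with h | h
      · exact hmid a b h hbN hdab
      · have := hmid b a h haN (by rw [hd.symm]; exact hdab)
        rw [hd.symm (p b)] at this
        linarith
    have h1 := idealDist_fourPoint hδ (p 0) (p N) t (p 0) (p b) (p a)
    have h2 := idealDist_fourPoint hδ (p 0) (p N) t (p 0) (p N) (p b)
    have s1 := hd.symm (p b) (p 0)
    rcases max_choice (D t (p 0) + d (p a) (p b)) (D t (p b) + d (p a) (p 0)) with h | h <;>
    rcases max_choice (D t (p 0) + d (p b) (p N)) (D t (p N) + d (p b) (p 0)) with h' | h' <;>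
    rw [h] at h1 <;> rw [h'] at h2 <;> nlinarith [mul_nonneg (Nat.cast_nonneg (α := ℝ) k) hδ0]
  have key : ∀ n : ℕ, (∀ t, 0 ≤ t → t ≤ ℓ → ∃ i, i ≤ N ∧ D t (p i) ≤ B₀ + n) →
      ∀ t, 0 ≤ t → t ≤ ℓ → ∃ i, i ≤ N ∧ D t (p i) ≤ B₀ := by
    intro n
    induction n with
    | zero => intro h; simpa using h
    | succ n ih =>
      intro h
      refine ih fun t h0 h1 => ?_
      obtain ⟨i, hi, hi'⟩ := descent _ (by have : (0 : ℝ) ≤ (n + 1 : ℕ) := by positivity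
                                           linarith) h t h0 h1
      exact ⟨i, hi, by push_cast at hi'; linarith⟩
  refine key ⌈ℓ⌉₊ fun t h0 h1 => ⟨0, Nat.zero_le _, ?_⟩
  rw [hD, idealDist_left hd h0]
  have := Nat.le_ceil ℓ
  linarith

/-- Points of a quasi-geodesic have bounded Gromov product of the endpoints. -/
theorem exists_morse_const (hd : IsMetric d) (hδ0 : 0 ≤ δ) (hδ : FourPoint d δ) {L C : ℝ}
    (hL : 0 ≤ L) (hC : 0 ≤ C) :
    ∃ K : ℝ, 0 ≤ K ∧ ∀ (p : ℕ → X) (N : ℕ), QuasiGeod d L C p N → ∀ i, i ≤ N →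
      d (p 0) (p i) + d (p i) (p N) ≤ d (p 0) (p N) + K := by
  obtain ⟨B, hB, hnear⟩ := exists_near_quasiGeod hd hδ0 hδ hL hC
  refine ⟨2 * (B + (L * (L * (2 * B + 1 + 2 * δ) + C) + C)), by positivity,
    fun p N hp i hi => ?_⟩
  set ℓ := d (p 0) (p N) with hℓ
  have hℓ0 : 0 ≤ ℓ := hd.nonneg _ _
  set D := idealDist d (p 0) (p N) with hD
  have hfin : ∀ t t' : ℝ, |t - t'| ≤ 1 → ∀ j j', j ≤ i → i ≤ j' → j' ≤ N → D t (p j) ≤ B →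
      D t' (p j') ≤ B →
      d (p 0) (p i) + d (p i) (p N) ≤
        ℓ + 2 * (B + (L * (L * (2 * B + 1 + 2 * δ) + C) + C)) := by
    intro t t' htt j j' hj hj' hjN h1 h2
    have h3 : d (p j) (p j') ≤ 2 * B + 1 + 2 * δ := by
      have := dist_le_idealDist_add hd hδ (p 0) (p N) t (p j) (p j')
      have := idealDist_le_add_abs (d := d) (p 0) (p N) t t' (p j')
      linarith
    have h4 := (hp j j' (hj.trans hj') hjN).2
    have h5 : L * d (p j) (p j') ≤ L * (2 * B + 1 + 2 * δ) := mul_le_mul_of_nonneg_left h3 hL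
    have h6 := (hp j i hj hi).1
    have h7 : L * ((i : ℝ) - j) ≤ L * (L * (2 * B + 1 + 2 * δ) + C) := by
      apply mul_le_mul_of_nonneg_left _ hL
      have : (i : ℝ) ≤ j' := by exact_mod_cast hj'
      linarith
    have h8 := idealDist_le_add_dist hd (p 0) (p N) t (p i) (p j)
    have h9 : d (p 0) (p i) - t ≤ D t (p i) := le_max_left _ _
    have h10 : d (p N) (p i) - (ℓ - t) ≤ D t (p i) := le_max_right _ _
    have := hd.symm (p i) (p N)
    linarith
  classical
  have hex : ∃ k : ℕ, ∃ j', i ≤ j' ∧ j' ≤ N ∧ D (min k ℓ) (p j') ≤ B := by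
    refine ⟨⌈ℓ⌉₊, N, hi, le_rfl, ?_⟩
    rw [min_eq_right (Nat.le_ceil ℓ), hD, idealDist_right hd le_rfl]
    linarith
  obtain ⟨j', hj', hjN, hDj'⟩ := Nat.find_spec hex
  rcases Nat.eq_zero_or_pos (Nat.find hex) with h0 | h0
  · rw [h0] at hDj'
    refine hfin 0 0 (by simp) 0 j' (Nat.zero_le _) hj' hjN ?_ ?_
    · rw [hD, idealDist_left hd le_rfl]; exact hB
    · simpa [hℓ0] using hDj'
  · have hmin := Nat.find_min hex (Nat.sub_lt h0 one_pos)
    set k := Nat.find hex with hk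
    obtain ⟨j, hjN', hDj⟩ := hnear p N hp (min ((k - 1 : ℕ) : ℝ) ℓ) (by positivity)
      (min_le_right _ _)
    have hji : j ≤ i := by
      by_contra! h
      exact hmin ⟨j, h.le, hjN', hDj⟩
    refine hfin _ _ ?_ j j' hji hj' hjN hDj hDj'
    have hkk : ((k - 1 : ℕ) : ℝ) = k - 1 := by
      rw [Nat.cast_sub h0]; simp
    rw [hkk]
    grind

end IdealPoint


section WordLength

variable {Γ : Type*} [Group Γ] {S : Set Γ}

theorem wordLength_prod_le {l : List Γ} (hl : ∀ a ∈ l, a ∈ S) :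
    wordLength S l.prod ≤ l.length :=
  Nat.sInf_le ⟨l, hl, rfl, rfl⟩

theorem IsSymmGen.exists_list (hS : IsSymmGen S) (x : Γ) :
    ∃ l : List Γ, (∀ a ∈ l, a ∈ S) ∧ l.length = wordLength S x ∧ l.prod = x := by
  have hne : {n : ℕ | ∃ l : List Γ, (∀ a ∈ l, a ∈ S) ∧ l.length = n ∧ l.prod = x}.Nonempty := by
    have hx : x ∈ Subgroup.closure S := by rw [hS.2.2]; trivial
    rw [← Subgroup.mem_toSubmonoid, Subgroup.closure_toSubmonoid] at hx
    obtain ⟨l, hl, rfl⟩ := Submonoid.exists_list_of_mem_closure hx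
    refine ⟨l.length, l, fun a ha => ?_, rfl, rfl⟩
    rcases hl a ha with h | h
    · exact h
    · simpa using hS.2.1 _ h
  exact Nat.sInf_mem hne

theorem wordLength_one : wordLength S (1 : Γ) = 0 :=
  Nat.le_zero.1 (wordLength_prod_le (l := []) (by simp))

theorem wordLength_mul_le (hS : IsSymmGen S) (x y : Γ) :
    wordLength S (x * y) ≤ wordLength S x + wordLength S y := by
  obtain ⟨l, hl, hlx, rfl⟩ := hS.exists_list x
  obtain ⟨m, hm, hmy, rfl⟩ := hS.exists_list y
  rw [← hlx, ← hmy, ← List.prod_append, ← List.length_append]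
  exact wordLength_prod_le fun a ha => (List.mem_append.1 ha).elim (hl a) (hm a)

theorem wordLength_inv_le (hS : IsSymmGen S) (x : Γ) :
    wordLength S x⁻¹ ≤ wordLength S x := by
  obtain ⟨l, hl, hlx, rfl⟩ := hS.exists_list x
  rw [← hlx, List.prod_inv_reverse]
  refine (wordLength_prod_le fun a ha => ?_).trans (by simp)
  simp only [List.mem_reverse, List.mem_map] at ha
  obtain ⟨b, hb, rfl⟩ := ha
  exact hS.2.1 b (hl b hb)

theorem wordLength_inv (hS : IsSymmGen S) (x : Γ) : wordLength S x⁻¹ = wordLength S x :=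
  le_antisymm (wordLength_inv_le hS x) (by simpa using wordLength_inv_le hS x⁻¹)

/-- The points `p 0, …, p N` form a word geodesic from `1` to `x`. -/
structure IsWordGeod (S : Set Γ) (x : Γ) (N : ℕ) (p : ℕ → Γ) : Prop where
  zero : p 0 = 1
  last : p N = x
  dist : ∀ i j, i ≤ j → j ≤ N → wordLength S ((p i)⁻¹ * p j) = j - i

theorem exists_wordGeod (hS : IsSymmGen S) (x : Γ) :
    ∃ p : ℕ → Γ, IsWordGeod S x (wordLength S x) p := by
  obtain ⟨l, hl, hlx, rfl⟩ := hS.exists_list x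
  have hle : ∀ i j, i ≤ j → wordLength S ((l.take i).prod⁻¹ * (l.take j).prod) ≤ j - i := by
    intro i j hij
    have h : (l.take j).prod = (l.take i).prod * ((l.take j).drop i).prod := by
      rw [← List.prod_append]
      congr 1
      conv_lhs => rw [← List.take_append_drop i (l.take j)]
      rw [List.take_take, min_eq_left hij]
    rw [h, inv_mul_cancel_left]
    refine (wordLength_prod_le fun a ha => hl a ?_).trans (by simp; omega)
    exact List.mem_of_mem_take (List.mem_of_mem_drop ha)
  refine ⟨fun i => (l.take i).prod, by simp, by simp [← hlx], fun i j hij hj => ?_⟩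
  refine le_antisymm (hle i j hij) ?_
  have h1 := hle 0 i (Nat.zero_le _)
  have h2 := hle j l.length (by omega)
  set N := wordLength S l.prod with hN
  simp only [List.take_zero, List.prod_nil, inv_one, one_mul, List.take_length] at h1 h2
  have h3 := wordLength_mul_le hS (l.take i).prod ((l.take i).prod⁻¹ * (l.take j).prod)
  have h4 := wordLength_mul_le hS (l.take j).prod ((l.take j).prod⁻¹ * l.prod)
  rw [mul_inv_cancel_left] at h3 h4
  omega

namespace IsWordGeod

variable {x : Γ} {N : ℕ} {p : ℕ → Γ}

theorem length_eq (hp : IsWordGeod S x N p) {i : ℕ} (hi : i ≤ N) : wordLength S (p i) = i := by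
  simpa [hp.zero] using hp.dist 0 i (Nat.zero_le _) hi

theorem length_rest (hp : IsWordGeod S x N p) {i : ℕ} (hi : i ≤ N) :
    wordLength S ((p i)⁻¹ * x) = N - i := by
  simpa [hp.last] using hp.dist i N hi le_rfl

end IsWordGeod

theorem finite_ball (hS : IsSymmGen S) (n : ℕ) : {x : Γ | wordLength S x ≤ n}.Finite := by
  have : Finite S := hS.1
  have h : {l : List S | l.length ≤ n}.Finite := List.finite_length_le S n
  refine (h.image fun l => (l.map Subtype.val).prod).subset fun x hx => ?_
  obtain ⟨l, hl, hlx, rfl⟩ := hS.exists_list x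
  refine ⟨l.attachWith (· ∈ S) hl, ?_, by simp⟩
  simpa [hlx] using hx

open scoped Pointwise in
open Classical in
theorem exists_card_ball_le (hS : IsSymmGen S) :
    ∃ M : ℕ, 1 ≤ M ∧ ∀ n : ℕ, Nat.card {x : Γ // wordLength S x ≤ n} ≤ M ^ n := by
  set A : Finset Γ := insert 1 hS.1.toFinset with hA
  have h1 : (1 : Γ) ∈ A := by simp [hA]
  refine ⟨A.card, Finset.card_pos.2 ⟨1, h1⟩, fun n => ?_⟩
  refine le_trans ?_ (Finset.card_pow_le (s := A) (n := n))
  rw [← Set.ncard_coe_finset]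
  refine Set.ncard_le_ncard (fun x hx => ?_) (Finset.finite_toSet _)
  obtain ⟨l, hl, hlx, rfl⟩ := hS.exists_list x
  have hx' : l.length ≤ n := hlx.trans_le hx
  refine Finset.pow_subset_pow_right h1 hx' ?_
  clear hlx hx hx'
  induction l with
  | nil => simp
  | cons a l ih =>
    rw [List.prod_cons, List.length_cons, pow_succ']
    exact Finset.mul_mem_mul (by simp [hA, hl a]) (ih fun b hb => hl b (by simp [hb]))

theorem exists_wordLength_le (hS : IsSymmGen S) {T : Set Γ} (hT : IsSymmGen T) :
    ∃ M : ℕ, ∀ x, wordLength S x ≤ M * wordLength T x := by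
  obtain ⟨M, hM⟩ := (hT.1.image (wordLength S)).bddAbove
  refine ⟨M, fun x => ?_⟩
  obtain ⟨l, hl, hlx, rfl⟩ := hT.exists_list x
  rw [← hlx]
  clear hlx
  induction l with
  | nil => simp [wordLength_one]
  | cons a l ih =>
    have h1 := wordLength_mul_le hS a l.prod
    have h2 := hM ⟨a, hl a (by simp), rfl⟩
    have h3 := ih fun b hb => hl b (by simp [hb])
    rw [List.prod_cons, List.length_cons]
    nlinarith

end WordLength


section Quasimorphism

variable {Γ : Type*} [Group Γ]

theorem infinite_of_not_virtuallyCyclic (h : ¬ VirtuallyCyclic Γ) : Infinite Γ := by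
  by_contra hfin
  rw [not_infinite_iff_finite] at hfin
  exact h ⟨⊥, inferInstance, 1, by simp⟩

/-- A group carrying a quasimorphism with finite level sets is virtually cyclic. -/
theorem virtuallyCyclic_of_quasimorphism {β : Γ → ℝ} {A : ℝ}
    (hA : ∀ g h, |β (g * h) - β g - β h| ≤ A) (hfin : ∀ c, {g | |β g| ≤ c}.Finite) :
    VirtuallyCyclic Γ := by
  by_contra hvc
  have hinf := infinite_of_not_virtuallyCyclic hvc
  obtain ⟨h, hh⟩ : ∃ h, 3 * A + 1 < |β h| := by
    by_contra! hall
    exact Set.infinite_univ ((hfin (3 * A + 1)).subset fun g _ => hall g)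
  set c := |β h| + 3 * A with hc
  have hA0 : 0 ≤ A := (abs_nonneg _).trans (hA 1 1)
  have h1 := hA h h⁻¹
  have h2 := hA 1 1
  rw [mul_inv_cancel] at h1
  rw [mul_one] at h2
  have key : ∀ n : ℕ, ∀ g, |β g| ≤ c + n → ∃ k : ℤ, |β (h ^ k * g)| ≤ c := by
    intro n
    induction n with
    | zero => intro g hg; exact ⟨0, by simpa using hg⟩
    | succ n ih =>
      intro g hg
      push_cast at hg
      by_cases hgc : |β g| ≤ c
      · exact ⟨0, by simpa using hgc⟩
      have h3 := hA h g
      have h4 := hA h⁻¹ g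
      have hstep : |β (h * g)| ≤ c + n ∨ |β (h⁻¹ * g)| ≤ c + n := by
        simp only [abs_le] at h1 h2 h3 h4 hg ⊢
        push Not at hgc
        rw [lt_abs] at hgc
        rcases abs_cases (β h) with ⟨e, _⟩ | ⟨e, _⟩ <;> rw [e] at hc hh <;>
          rcases hgc with hgc | hgc
        · right; constructor <;> linarith
        · left; constructor <;> linarith
        · left; constructor <;> linarith
        · right; constructor <;> linarith
      rcases hstep with h5 | h5
      · obtain ⟨k, hk⟩ := ih _ h5
        exact ⟨k + 1, by rwa [zpow_add_one, mul_assoc]⟩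
      · obtain ⟨k, hk⟩ := ih _ h5
        exact ⟨k - 1, by rwa [zpow_sub_one, mul_assoc]⟩
  refine hvc ⟨Subgroup.zpowers h, ?_, h, rfl⟩
  have hsurj : (Set.univ : Set (Γ ⧸ Subgroup.zpowers h)) ⊆
      (fun f : Γ => (QuotientGroup.mk f⁻¹ : Γ ⧸ Subgroup.zpowers h)) '' {g | |β g| ≤ c} := by
    intro q _
    obtain ⟨g, rfl⟩ := QuotientGroup.mk_surjective q
    obtain ⟨k, hk⟩ := key ⌈|β g⁻¹| - c⌉₊ g⁻¹ (by have := Nat.le_ceil (|β g⁻¹| - c); linarith)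
    refine ⟨h ^ k * g⁻¹, hk, ?_⟩
    rw [QuotientGroup.eq]
    exact ⟨k, by simp⟩
  have : Finite (Γ ⧸ Subgroup.zpowers h) :=
    Set.finite_univ_iff.1 (((hfin c).image _).subset hsurj)
  exact Subgroup.finiteIndex_of_finite_quotient

end Quasimorphism

section Geometry

variable {Γ : Type*} [Group Γ]

/-- A left-invariant `δ`-hyperbolic metric comparable with the word length of `S`, such that
word geodesics are almost geodesic. -/
structure GroupGeom (d : Γ → Γ → ℝ) (S : Set Γ) (δ L C K : ℝ) : Prop where
  metric : IsMetric d
  leftInv : ∀ g x y : Γ, d (g * x) (g * y) = d x y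
  symmGen : IsSymmGen S
  hδ : 0 ≤ δ
  fourPoint : FourPoint d δ
  hL : 0 ≤ L
  hC : 0 ≤ C
  hK : 0 ≤ K
  word_le : ∀ x, (wordLength S x : ℝ) ≤ L * d 1 x + C
  le_word : ∀ x, d 1 x ≤ L * wordLength S x + C
  morse : ∀ x p, IsWordGeod S x (wordLength S x) p → ∀ i, i ≤ wordLength S x →
    d 1 (p i) + d (p i) x ≤ d 1 x + K

theorem exists_groupGeom {d : Γ → Γ → ℝ} {S : Set Γ} (hd : InD d) (hS : IsSymmGen S) :
    ∃ δ L C K, GroupGeom d S δ L C K := by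
  obtain ⟨δ, hδ0, hδ⟩ := hd.hyp
  obtain ⟨T, hT, L₁, C₁, hL₁, hC₁, hqi⟩ := hd.qi
  obtain ⟨M, hM⟩ := exists_wordLength_le hS hT
  obtain ⟨M', hM'⟩ := exists_wordLength_le hT hS
  set L := L₁ * (M + M') with hL
  set C := M * L₁ * C₁ + C₁ with hC
  have hL0 : 0 ≤ L := by positivity
  have hC0 : 0 ≤ C := by positivity
  have hd0 := hd.metric.nonneg
  have hw : ∀ x, (wordLength S x : ℝ) ≤ L * d 1 x + C := by
    intro x
    have h1 := (hqi 1 x).1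
    have h2 : (wordLength S x : ℝ) ≤ M * wordLength T x := by exact_mod_cast hM x
    rw [wordDist, inv_one, one_mul, sub_le_iff_le_add, div_le_iff₀ hL₁] at h1
    have h3 : (M : ℝ) * wordLength T x ≤ M * ((d 1 x + C₁) * L₁) := by gcongr
    have h4 : 0 ≤ L₁ * M' * d 1 x := mul_nonneg (by positivity) (hd0 _ _)
    rw [hL, hC]
    nlinarith
  have hw' : ∀ x, d 1 x ≤ L * wordLength S x + C := by
    intro x
    have h1 := (hqi 1 x).2
    have h2 : (wordLength T x : ℝ) ≤ M' * wordLength S x := by exact_mod_cast hM' x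
    rw [wordDist, inv_one, one_mul] at h1
    have h3 : L₁ * wordLength T x ≤ L₁ * (M' * wordLength S x) := by gcongr
    have h4 : 0 ≤ L₁ * M * wordLength S x := by positivity
    have h5 : 0 ≤ M * L₁ * C₁ := by positivity
    rw [hL, hC]
    nlinarith
  have hfour := fourPoint_of_gromov hd.metric hδ
  obtain ⟨K, hK, hmorse⟩ := exists_morse_const hd.metric hδ0 hfour hL0 hC0
  refine ⟨δ, L, C, K, hd.metric, hd.leftInv, hS, hδ0, hfour, hL0, hC0, hK, hw, hw',
    fun x p hp i hi => ?_⟩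
  have hq : QuasiGeod d L C p (wordLength S x) := by
    intro i j hij hj
    have e : d (p i) (p j) = d 1 ((p i)⁻¹ * p j) := by
      rw [← hd.leftInv (p i)⁻¹, inv_mul_cancel]
    have e' : ((wordLength S ((p i)⁻¹ * p j) : ℕ) : ℝ) = j - i := by
      rw [hp.dist i j hij hj, Nat.cast_sub hij]
    rw [e, ← e']
    exact ⟨hw' _, hw _⟩
  simpa [hp.zero, hp.last] using hmorse p _ hq i hi

namespace GroupGeom

variable {d : Γ → Γ → ℝ} {S : Set Γ} {δ L C K : ℝ} (G : GroupGeom d S δ L C K)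
include G

theorem nonneg (x y : Γ) : 0 ≤ d x y := G.metric.nonneg x y

theorem dist_eq (x y : Γ) : d x y = d 1 (x⁻¹ * y) := by
  rw [← G.leftInv x⁻¹, inv_mul_cancel]

theorem dist_self_mul (x y : Γ) : d x (x * y) = d 1 y := by
  rw [G.dist_eq, inv_mul_cancel_left]

theorem dist_inv (x : Γ) : d 1 x⁻¹ = d 1 x := by
  rw [← G.leftInv x, mul_one, mul_inv_cancel, G.metric.symm]

theorem dist_mul_le (x y : Γ) : d 1 (x * y) ≤ d 1 x + d 1 y := by
  rw [← G.dist_self_mul x y]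
  exact G.metric.triangle _ _ _

theorem finite_dist_le (r : ℝ) : {x : Γ | d 1 x ≤ r}.Finite := by
  refine (finite_ball G.symmGen ⌊L * r + C⌋₊).subset fun x hx => Nat.le_floor ?_
  exact (G.word_le x).trans (add_le_add_left (mul_le_mul_of_nonneg_left hx G.hL) C)

/-- A point almost between `1` and `w` is close to every word geodesic from `1` to `w`. -/
theorem exists_near_wordGeod {w y : Γ} {p : ℕ → Γ} (hp : IsWordGeod S w (wordLength S w) p)
    {c : ℝ} (hc : 0 ≤ c) (hy : d 1 y + d y w ≤ d 1 w + c) :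
    ∃ i, i ≤ wordLength S w ∧ d y (p i) ≤ K + c + L + C + 2 * δ := by
  classical
  have hδ := G.hδ
  have hL := G.hL
  have hC := G.hC
  have hK := G.hK
  set N := wordLength S w with hN
  set i := Nat.findGreatest (fun i => d 1 (p i) ≤ d 1 y) N with hi
  have hiN : i ≤ N := Nat.findGreatest_le _
  have hi1 : d 1 (p i) ≤ d 1 y :=
    Nat.findGreatest_spec (P := fun i => d 1 (p i) ≤ d 1 y) (Nat.zero_le N)
      (by rw [hp.zero, G.metric.refl]; exact G.nonneg _ _)
  refine ⟨i, hiN, ?_⟩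
  rcases hiN.eq_or_lt with h | h
  · rw [h, hp.last]
    rw [h, hp.last] at hi1
    linarith
  · have h1 : d 1 y < d 1 (p (i + 1)) := by
      have := Nat.findGreatest_is_greatest (P := fun i => d 1 (p i) ≤ d 1 y) (n := N)
        (Nat.lt_succ_self i) h
      exact not_le.1 this
    have h2 : d (p i) (p (i + 1)) ≤ L + C := by
      have h3 := G.le_word ((p i)⁻¹ * p (i + 1))
      rw [hp.dist i (i + 1) (Nat.le_succ _) h, ← G.dist_eq] at h3
      simpa using h3
    have h3 := G.metric.triangle 1 (p i) (p (i + 1))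
    have h4 := G.morse w p hp i hiN
    have h5 := G.fourPoint y (p i) 1 w
    have e1 := G.metric.symm y 1
    have e2 := G.metric.symm (p i) 1
    rcases max_choice (d y 1 + d (p i) w) (d y w + d (p i) 1) with h | h <;>
      rw [h] at h5 <;> linarith

theorem busemann_close {z w h : Γ} (hzw : 2 * d 1 h ≤ d 1 z + d 1 w - d z w) :
    |(d 1 z - d h z) - (d 1 w - d h w)| ≤ 2 * δ := by
  have h1 := G.fourPoint h z 1 w
  have h2 := G.fourPoint h w 1 z
  have e1 := G.metric.symm h 1
  have e2 := G.metric.symm z w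
  have e3 := G.metric.symm z 1
  have e4 := G.metric.symm w 1
  have t1 := G.metric.triangle 1 h w
  have t2 := G.metric.triangle 1 h z
  rw [abs_le]
  constructor <;> grind

theorem dist_mul_right_le {z g x : Γ} {c : ℝ} (hx : d 1 x + d x z ≤ d 1 z + K)
    (hg : |d 1 z - d g z| ≤ c) (hgx : d 1 g + K ≤ d 1 x)
    (hz : 2 * d 1 x ≤ d 1 z + d 1 (g⁻¹ * z) - d z (g⁻¹ * z)) :
    d x (g * x) ≤ 3 * c + K + 6 * δ := by
  have hδ := G.hδ
  have hK := G.hK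
  have hc := (abs_nonneg _).trans hg
  have h1 := G.busemann_close hz
  have e1 : d 1 (g⁻¹ * z) = d g z := by rw [← G.leftInv g]; simp
  have e2 : d x (g⁻¹ * z) = d (g * x) z := by rw [← G.leftInv g]; simp
  have e3 : d g (g * x) = d 1 x := G.dist_self_mul _ _
  rw [e1, e2] at h1
  rw [abs_le] at h1 hg
  have h2 := G.fourPoint x g 1 z
  have h3 := G.fourPoint x (g * x) g z
  have e4 := G.metric.symm x 1
  have e5 := G.metric.symm g 1
  have e6 := G.metric.symm (g * x) g
  have := G.nonneg 1 x
  rcases max_choice (d x 1 + d g z) (d x z + d g 1) with h | h <;> rw [h] at h2 <;>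
  rcases max_choice (d x g + d (g * x) z) (d x z + d (g * x) g) with h' | h' <;> rw [h'] at h3 <;>
  linarith

/-- No point at infinity is fixed by a group which is not virtually cyclic. -/
theorem exists_displacement (hvc : ¬ VirtuallyCyclic Γ) :
    ∃ (F : Finset Γ) (c : ℝ), ∀ z, ∃ g ∈ F, d 1 z + d 1 (g * z) - d z (g * z) ≤ c := by
  by_contra! hcon
  have hz : ∀ k : ℕ, ∃ z, ∀ g, wordLength S g ≤ k →
      (k : ℝ) < d 1 z + d 1 (g * z) - d z (g * z) := by
    intro k
    obtain ⟨z, hz⟩ := hcon (finite_ball G.symmGen k).toFinset k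
    exact ⟨z, fun g hg => hz g (by simpa using hg)⟩
  choose z hz using hz
  set U : Ultrafilter ℕ := hyperfilter ℕ with hU
  have hUtop : (U : Filter ℕ) ≤ atTop := Nat.hyperfilter_le_atTop
  have hlim : ∀ g, ∃ ℓ, Tendsto (fun k => d 1 (z k) - d g (z k)) U (𝓝 ℓ) := by
    intro g
    obtain ⟨ℓ, _, hℓ⟩ := (isCompact_Icc (a := -d 1 g) (b := d 1 g)).ultrafilter_le_nhds
      (U.map fun k => d 1 (z k) - d g (z k)) (by
        rw [le_principal_iff, Ultrafilter.mem_coe, Ultrafilter.mem_map]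
        refine Filter.univ_mem' fun k => ?_
        have h1 := G.metric.triangle 1 g (z k)
        have h2 := G.metric.triangle g 1 (z k)
        rw [G.metric.symm g 1] at h2
        simp only [Set.mem_preimage, Set.mem_Icc]
        constructor <;> linarith)
    exact ⟨ℓ, hℓ⟩
  choose β hβ using hlim
  have hlarge : ∀ r : ℝ, ∀ᶠ k : ℕ in U, r ≤ k := fun r =>
    (tendsto_natCast_atTop_atTop.eventually_ge_atTop r).filter_mono hUtop
  have hword : ∀ g, ∀ᶠ k : ℕ in U, wordLength S g ≤ k := fun g =>
    (eventually_ge_atTop _).filter_mono hUtop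
  refine hvc (virtuallyCyclic_of_quasimorphism (β := β) (A := 2 * δ) (fun g h => ?_) fun c => ?_)
  · refine le_of_tendsto (((hβ (g * h)).sub (hβ g)).sub (hβ h)).abs ?_
    filter_upwards [hlarge (2 * d 1 h), hword g⁻¹] with k hk1 hk2
    have h1 := G.busemann_close (hk1.trans (hz k g⁻¹ hk2).le)
    have e1 : d 1 (g⁻¹ * z k) = d g (z k) := by rw [← G.leftInv g]; simp
    have e2 : d h (g⁻¹ * z k) = d (g * h) (z k) := by rw [← G.leftInv g]; simp
    rw [e1, e2, abs_sub_comm] at h1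
    refine (congrArg _ ?_).trans_le h1
    ring
  · by_contra hinf
    set B := (G.finite_dist_le (3 * (c + 1) + K + 6 * δ)).toFinset with hB
    obtain ⟨t, hts, htc⟩ := Set.Infinite.exists_subset_card_eq hinf (B.card + 1)
    obtain ⟨T, hT⟩ := (t.image (d 1)).bddAbove
    set m := ⌊L * (T + K) + C⌋₊ + 1 with hm
    have hev : ∀ᶠ k : ℕ in U, ∀ g ∈ t,
        |d 1 (z k) - d g (z k)| ≤ c + 1 ∧ wordLength S g⁻¹ ≤ k := by
      rw [Filter.eventually_all_finset]
      intro g hg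
      refine Filter.Eventually.and ?_ (hword g⁻¹)
      have : |β g| < c + 1 := lt_of_le_of_lt (hts hg) (by linarith)
      exact ((hβ g).abs.eventually_lt_const this).mono fun k hk => hk.le
    obtain ⟨k, hk1, hk2⟩ := (hev.and (hlarge (2 * (L * m + C)))).exists
    have hmz : m ≤ wordLength S (z k) := by
      by_contra! hlt
      have h1 := hz k 1 (by simp [wordLength_one])
      have h2 := G.le_word (z k)
      have h3 : L * (wordLength S (z k) : ℝ) ≤ L * m := by
        have := G.hL
        gcongr
      rw [one_mul, G.metric.refl] at h1
      linarith
    obtain ⟨p, hp⟩ := exists_wordGeod G.symmGen (z k)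
    set x := p m with hx
    have hxm : wordLength S x = m := hp.length_eq hmz
    have hxT : T + K ≤ d 1 x := by
      have h1 := G.word_le x
      have h2 := Nat.lt_floor_add_one (L * (T + K) + C)
      rw [hxm, hm] at h1
      push_cast at h1
      exact (lt_of_mul_lt_mul_left (by linarith) G.hL).le
    have hxm' : d 1 x ≤ L * m + C := by
      have := G.le_word x
      rwa [hxm] at this
    have hmaps : ∀ g ∈ t, x⁻¹ * (g * x) ∈ B := by
      intro g hg
      rw [hB, Set.Finite.mem_toFinset, Set.mem_ofPred_eq, ← G.dist_eq]
      have hgT : d 1 g ≤ T := hT (by simpa using ⟨g, hg, rfl⟩)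
      refine G.dist_mul_right_le (G.morse _ p hp m hmz) (hk1 g hg).1 (by linarith) ?_
      have := hz k g⁻¹ (hk1 g hg).2
      linarith
    have := Finset.card_le_card_of_injOn (fun g => x⁻¹ * (g * x)) hmaps
      (fun g _ g' _ h => by simpa using h)
    omega

theorem exists_connector (hvc : ¬ VirtuallyCyclic Γ) :
    ∃ (F : Finset Γ) (c : ℝ), 0 ≤ c ∧
      ∀ y z, ∃ f ∈ F, d 1 y + d 1 (f * z) ≤ d 1 (y * f * z) + c := by
  classical
  obtain ⟨F, c, hF⟩ := G.exists_displacement hvc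
  refine ⟨insert 1 F, |c| + 2 * δ, by have := G.hδ; positivity, fun y z => ?_⟩
  obtain ⟨g, hg, hgz⟩ := hF z
  by_contra! hcon
  have h1 := hcon 1 (by simp)
  have h2 := hcon g (by simp [hg])
  have e1 : d 1 (y * 1 * z) = d y⁻¹ z := by rw [G.dist_eq y⁻¹]; simp
  have e2 : d 1 (y * g * z) = d y⁻¹ (g * z) := by rw [G.dist_eq y⁻¹]; simp [mul_assoc]
  rw [e1, one_mul] at h1
  rw [e2] at h2
  have e3 := G.dist_inv y
  have h3 := G.fourPoint z (g * z) y⁻¹ 1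
  have e4 := G.metric.symm z y⁻¹
  have e5 := G.metric.symm (g * z) y⁻¹
  have e6 := G.metric.symm (g * z) 1
  have e7 := G.metric.symm z 1
  have e8 := G.metric.symm y⁻¹ 1
  have := le_abs_self c
  rcases max_choice (d z y⁻¹ + d (g * z) 1) (d z 1 + d (g * z) y⁻¹) with h | h <;>
    rw [h] at h3 <;> linarith

end GroupGeom

end Geometry


theorem sum_le_sum_of_injOn {ι κ : Type*} {s : Finset ι} {t : Finset κ} {f : ι → ℝ} {g : κ → ℝ}
    (e : ι → κ) (he : ∀ i ∈ s, e i ∈ t) (hinj : Set.InjOn e s) (hfg : ∀ i ∈ s, f i ≤ g (e i))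
    (hg : ∀ k ∈ t, 0 ≤ g k) : ∑ i ∈ s, f i ≤ ∑ k ∈ t, g k := by
  classical
  calc ∑ i ∈ s, f i ≤ ∑ i ∈ s, g (e i) := Finset.sum_le_sum hfg
    _ = ∑ k ∈ s.image e, g k := (Finset.sum_image hinj).symm
    _ ≤ ∑ k ∈ t, g k := Finset.sum_le_sum_of_subset_of_nonneg
        (Finset.image_subset_iff.2 he) fun k hk _ => hg k hk

section SphereSums

variable {Γ : Type*} [Group Γ]

/-- The sum of `exp (-s * d 1 x)` over the word sphere of radius `n`. -/
noncomputable def sphSum (d : Γ → Γ → ℝ) (S : Set Γ) (s : ℝ) (n : ℕ) : ℝ :=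
  ∑' x : {x : Γ // wordLength S x = n}, Real.exp (-s * d 1 x)

namespace GroupGeom

variable {d : Γ → Γ → ℝ} {S : Set Γ} {δ L C K : ℝ} (G : GroupGeom d S δ L C K)
include G

theorem finite_sphere (n : ℕ) : {x : Γ | wordLength S x = n}.Finite :=
  (finite_ball G.symmGen n).subset fun _ hx => hx.le

/-- The word sphere of radius `n`. -/
noncomputable def sphere (n : ℕ) : Finset Γ := (G.finite_sphere n).toFinset

theorem mem_sphere {n : ℕ} {x : Γ} : x ∈ G.sphere n ↔ wordLength S x = n := by
  simp [sphere]

theorem sphSum_eq (s : ℝ) (n : ℕ) :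
    sphSum d S s n = ∑ x ∈ G.sphere n, Real.exp (-s * d 1 x) := by
  rw [← Finset.tsum_subtype, sphSum]
  exact ((Equiv.subtypeEquivRight fun x => G.mem_sphere).tsum_eq
    fun x : {x // wordLength S x = n} => Real.exp (-s * d 1 x)).symm

theorem sphSum_nonneg (s : ℝ) (n : ℕ) : 0 ≤ sphSum d S s n := by
  rw [G.sphSum_eq]
  positivity

theorem continuous_sphSum (n : ℕ) : Continuous fun s => sphSum d S s n := by
  simp only [G.sphSum_eq]
  fun_prop

theorem sphSum_add_le {s : ℝ} (hs : 0 ≤ s) (n m : ℕ) :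
    sphSum d S s (n + m) ≤ Real.exp (s * K) * (sphSum d S s n * sphSum d S s m) := by
  choose p hp using fun x => exists_wordGeod G.symmGen x
  rw [G.sphSum_eq, G.sphSum_eq, G.sphSum_eq, Finset.sum_mul_sum, ← Finset.sum_product',
    Finset.mul_sum]
  refine sum_le_sum_of_injOn (fun x => (p x n, (p x n)⁻¹ * x)) (fun x hx => ?_) ?_
    (fun x hx => ?_) fun k _ => by positivity
  · rw [G.mem_sphere] at hx
    have hn : n ≤ wordLength S x := by omega
    rw [Finset.mem_product, G.mem_sphere, G.mem_sphere]
    refine ⟨(hp x).length_eq hn, ?_⟩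
    rw [(hp x).length_rest hn, hx]
    omega
  · intro x _ y _ hxy
    obtain ⟨h1, h2⟩ := Prod.mk.inj hxy
    rw [h1] at h2
    exact mul_left_cancel h2
  · rw [G.mem_sphere] at hx
    have hn : n ≤ wordLength S x := by omega
    have h := G.morse x (p x) (hp x) n hn
    rw [G.dist_eq (p x n)] at h
    rw [← Real.exp_add, ← Real.exp_add, Real.exp_le_exp]
    nlinarith

theorem exists_le_sphSum_add (hvc : ¬ VirtuallyCyclic Γ) :
    ∃ (R Q : ℕ) (A : ℝ), 1 ≤ Q ∧ 0 ≤ A ∧ ∀ s, 0 ≤ s → ∀ n m,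
      sphSum d S s (n + R) * sphSum d S s (m + R) ≤
        Q * Real.exp (s * A) * sphSum d S s (n + m + R) := by
  classical
  obtain ⟨F, c, hc, hF⟩ := G.exists_connector hvc
  choose f hfF hf using hF
  choose p hp using fun x => exists_wordGeod G.symmGen x
  have hL := G.hL
  have hC := G.hC
  obtain ⟨ℓ, hℓ⟩ := (F.image (wordLength S)).bddAbove
  replace hℓ : ∀ g ∈ F, wordLength S g ≤ ℓ := fun g hg => hℓ (by simpa using ⟨g, hg, rfl⟩)
  obtain ⟨r, hr⟩ := (F.image (d 1)).bddAbove
  replace hr : ∀ g ∈ F, d 1 g ≤ r := fun g hg => hr (by simpa using ⟨g, hg, rfl⟩)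
  have hr0 : 0 ≤ r := (G.nonneg 1 _).trans (hr _ (hfF 1 1))
  set E := ⌊L * (K + c + L + C + 2 * δ) + C⌋₊ with hE
  have hnear : ∀ y z, ∃ i, i ≤ wordLength S (y * f y z * z) ∧
      wordLength S (y⁻¹ * p (y * f y z * z) i) ≤ E := by
    intro y z
    have h1 := hf y z
    rw [← G.dist_self_mul y (f y z * z), ← mul_assoc] at h1
    obtain ⟨i, hi, h2⟩ := G.exists_near_wordGeod (hp _) hc h1
    refine ⟨i, hi, Nat.le_floor ((G.word_le _).trans ?_)⟩
    rw [← G.dist_eq]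
    gcongr
  choose i hi hnear using hnear
  set R := ℓ + 2 * E with hR
  set P := ((Finset.range (2 * E + 1) ×ˢ F) ×ˢ (finite_ball G.symmGen E).toFinset) ×ˢ
    (finite_ball G.symmGen (R + ℓ)).toFinset with hP
  have hQ : P.Nonempty := by
    refine ⟨(((0, f 1 1), 1), 1), ?_⟩
    simp [hP, hfF, wordLength_one]
  refine ⟨R, P.card, r + (L * (R + ℓ) + C), Finset.card_pos.2 hQ, by positivity,
    fun s hs n m => ?_⟩
  rw [G.sphSum_eq, G.sphSum_eq, G.sphSum_eq, Finset.sum_mul_sum, ← Finset.sum_product']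
  have hsum : (P.card : ℝ) * Real.exp (s * (r + (L * (R + ℓ) + C))) *
      ∑ x ∈ G.sphere (n + m + R), Real.exp (-s * d 1 x) =
      ∑ q ∈ G.sphere (n + m + R) ×ˢ P,
        Real.exp (s * (r + (L * (R + ℓ) + C))) * Real.exp (-s * d 1 q.1) := by
    rw [Finset.sum_product, Finset.mul_sum]
    simp [mul_assoc]
  rw [hsum]
  set w : Γ × Γ → Γ := fun q => q.1 * f q.1 q.2 * q.2 with hw
  set u : Γ × Γ → Γ := fun q => p (w q) (n + m + R) with hu
  have hlen : ∀ q ∈ G.sphere (n + R) ×ˢ G.sphere (m + R),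
      n + m + R ≤ wordLength S (w q) ∧ wordLength S (w q) ≤ n + m + R + (R + ℓ) ∧
      i q.1 q.2 ≤ n + R + E ∧ n + R ≤ i q.1 q.2 + E := by
    rintro ⟨y, z⟩ hq
    rw [Finset.mem_product, G.mem_sphere, G.mem_sphere] at hq
    obtain ⟨hy, hz⟩ := hq
    simp only at hy hz ⊢
    have h1 := hnear y z
    have h2 := hi y z
    have h3 := (hp (y * f y z * z)).length_eq h2
    have h4 := (hp (y * f y z * z)).length_rest h2
    have h5 := wordLength_mul_le G.symmGen (y * f y z) z
    have h6 := wordLength_mul_le G.symmGen y (f y z)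
    have h7 := hℓ _ (hfF y z)
    simp only [hw]
    set g := p (y * f y z * z) (i y z) with hg
    have h8 := wordLength_mul_le G.symmGen y (y⁻¹ * g)
    have h9 := wordLength_mul_le G.symmGen g (y⁻¹ * g)⁻¹
    have h10 := wordLength_mul_le G.symmGen (y⁻¹ * g) (g⁻¹ * (y * f y z * z))
    have h11 := wordLength_mul_le G.symmGen (f y z)⁻¹ (f y z * z)
    rw [wordLength_inv G.symmGen] at h9 h11
    rw [mul_inv_cancel_left] at h8
    rw [inv_mul_cancel_left] at h11
    have e1 : g * (y⁻¹ * g)⁻¹ = y := by group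
    have e2 : y⁻¹ * g * (g⁻¹ * (y * f y z * z)) = f y z * z := by group
    rw [e1] at h9
    rw [e2] at h10
    omega
  have hrest : ∀ q ∈ G.sphere (n + R) ×ˢ G.sphere (m + R),
      wordLength S ((u q)⁻¹ * w q) ≤ R + ℓ := by
    intro q hq
    obtain ⟨h1, h2, -⟩ := hlen q hq
    rw [hu, (hp (w q)).length_rest h1]
    omega
  refine sum_le_sum_of_injOn (fun q => (u q, (((i q.1 q.2 + E - (n + R), f q.1 q.2),
    q.1⁻¹ * p (w q) (i q.1 q.2)), (u q)⁻¹ * w q))) (fun q hq => ?_) ?_ (fun q hq => ?_)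
    fun k _ => by positivity
  · have h1 := hrest q hq
    obtain ⟨h2, -, h3, h4⟩ := hlen q hq
    simp only [hP, Finset.mem_product, G.mem_sphere, Finset.mem_range, Set.Finite.mem_toFinset,
      Set.mem_ofPred_eq]
    exact ⟨(hp (w q)).length_eq h2, ⟨⟨by omega, hfF _ _⟩, hnear _ _⟩, h1⟩
  · rintro ⟨y, z⟩ hq ⟨y', z'⟩ hq' heq
    obtain ⟨-, -, h3, h4⟩ := hlen _ hq
    obtain ⟨-, -, h3', h4'⟩ := hlen _ hq'
    simp only [Prod.mk.injEq] at heq h3 h4 h3' h4'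
    obtain ⟨h5, ⟨⟨h6, h7⟩, h8⟩, h9⟩ := heq
    rw [h5] at h9
    have h10 : w (y, z) = w (y', z') := mul_left_cancel h9
    have h11 : i y z = i y' z' := by omega
    rw [h10, h11] at h8
    have h12 : y = y' := inv_injective (mul_right_cancel h8)
    subst h12
    simp only [hw, h7] at h10
    rw [mul_left_cancel h10]
  · have h1 := hrest q hq
    have h2 := G.le_word ((u q)⁻¹ * w q)
    have h3 : L * (wordLength S ((u q)⁻¹ * w q) : ℝ) ≤ L * (R + ℓ) := by
      gcongr
      exact_mod_cast h1
    have h4 := G.dist_mul_le (w q) ((u q)⁻¹ * w q)⁻¹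
    have e1 : w q * ((u q)⁻¹ * w q)⁻¹ = u q := by group
    rw [G.dist_inv, e1] at h4
    have h5 := G.dist_mul_le (q.1 * f q.1 q.2) q.2
    have h6 := G.dist_mul_le q.1 (f q.1 q.2)
    have h7 := hr _ (hfF q.1 q.2)
    rw [← Real.exp_add, ← Real.exp_add, Real.exp_le_exp]
    have h8 : d 1 (u q) ≤ d 1 q.1 + d 1 q.2 + (r + (L * (R + ℓ) + C)) := by
      simp only [hw] at h2 h3 h4 ⊢
      linarith
    nlinarith

end GroupGeom
end SphereSums


section GrowthRate

variable {Γ : Type*} [Group Γ]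

namespace GroupGeom

variable {d : Γ → Γ → ℝ} {S : Set Γ} {δ L C K : ℝ} (G : GroupGeom d S δ L C K)
include G

theorem one_le_card (n : ℕ) : (1 : ℝ) ≤ Nat.card {x : Γ // d 1 x ≤ (n : ℝ)} := by
  have : Finite {x : Γ // d 1 x ≤ (n : ℝ)} := G.finite_dist_le n
  have : Nonempty {x : Γ // d 1 x ≤ (n : ℝ)} := ⟨1, by rw [G.metric.refl]; positivity⟩
  exact_mod_cast Nat.card_pos

theorem log_card_nonneg (n : ℕ) :
    0 ≤ Real.log (Nat.card {x : Γ // d 1 x ≤ (n : ℝ)}) / (n : ℝ) :=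
  div_nonneg (Real.log_nonneg (G.one_le_card n)) (Nat.cast_nonneg n)

theorem exists_log_card_le :
    ∃ B : ℝ, ∀ n : ℕ, Real.log (Nat.card {x : Γ // d 1 x ≤ (n : ℝ)}) / (n : ℝ) ≤ B := by
  obtain ⟨M, hM, hcard⟩ := exists_card_ball_le G.symmGen
  have hL := G.hL
  have hC := G.hC
  have hlog : 0 ≤ Real.log M := Real.log_nonneg (by exact_mod_cast hM)
  refine ⟨(L + C) * Real.log M, fun n => ?_⟩
  rcases Nat.eq_zero_or_pos n with rfl | hn
  · simp only [Nat.cast_zero, div_zero]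
    positivity
  have hn' : (1 : ℝ) ≤ n := by exact_mod_cast hn
  rw [div_le_iff₀ (by positivity)]
  set k := ⌊L * n + C⌋₊ with hk
  have hle : Nat.card {x : Γ // d 1 x ≤ (n : ℝ)} ≤ M ^ k := by
    refine (Nat.card_mono (finite_ball G.symmGen k) fun x hx => Nat.le_floor ?_).trans (hcard k)
    exact (G.word_le x).trans (add_le_add_left (mul_le_mul_of_nonneg_left hx hL) C)
  calc Real.log (Nat.card {x : Γ // d 1 x ≤ (n : ℝ)}) ≤ Real.log ((M : ℝ) ^ k) :=
        Real.log_le_log (by linarith [G.one_le_card n]) (by exact_mod_cast hle)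
    _ = k * Real.log M := Real.log_pow _ _
    _ ≤ (L * n + C) * Real.log M := by
        gcongr
        exact Nat.floor_le (by positivity)
    _ ≤ (L + C) * Real.log M * n := by nlinarith [mul_nonneg hC hlog]

theorem isBoundedUnder_log_card : IsBoundedUnder (· ≤ ·) atTop
    fun n : ℕ => Real.log (Nat.card {x : Γ // d 1 x ≤ (n : ℝ)}) / (n : ℝ) := by
  obtain ⟨B, hB⟩ := G.exists_log_card_le
  exact isBoundedUnder_of ⟨B, hB⟩

theorem growthRate_nonneg : 0 ≤ growthRate d :=
  le_limsup_of_frequently_le (Frequently.of_forall G.log_card_nonneg) G.isBoundedUnder_log_card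

theorem summable_of_growthRate_lt {s : ℝ} (hs : growthRate d < s) :
    Summable fun x => Real.exp (-s * d 1 x) := by
  obtain ⟨t, hvt, hts⟩ := exists_between hs
  have ht : 0 ≤ t := G.growthRate_nonneg.trans hvt.le
  have hs0 : 0 ≤ s := ht.trans hts.le
  have hev := eventually_lt_of_limsup_lt hvt G.isBoundedUnder_log_card
  obtain ⟨c, hc0, hc⟩ : ∃ c : ℝ, 0 ≤ c ∧ ∀ n : ℕ,
      (Nat.card {x : Γ // d 1 x ≤ (n : ℝ)} : ℝ) ≤ c * Real.exp (t * n) := by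
    obtain ⟨N, hN⟩ := eventually_atTop.1 (hev.and (eventually_gt_atTop 0))
    refine ⟨Nat.card {x : Γ // d 1 x ≤ (N : ℝ)}, by positivity, fun n => ?_⟩
    have hexp : 1 ≤ Real.exp (t * n) := Real.one_le_exp (by positivity)
    rcases le_total N n with h | h
    · obtain ⟨h1, h2⟩ := hN n h
      rw [div_lt_iff₀ (by exact_mod_cast h2)] at h1
      have h3 := (Real.log_le_iff_le_exp (by linarith [G.one_le_card n])).1 h1.le
      nlinarith [G.one_le_card N]
    · have h3 : (Nat.card {x : Γ // d 1 x ≤ (n : ℝ)} : ℝ) ≤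
          Nat.card {x : Γ // d 1 x ≤ (N : ℝ)} := by
        have hmono : {x : Γ | d 1 x ≤ (n : ℝ)} ⊆ {x : Γ | d 1 x ≤ (N : ℝ)} := fun x hx =>
          le_trans (show d 1 x ≤ n from hx) (show (n : ℝ) ≤ N from mod_cast h)
        exact_mod_cast Nat.card_mono (G.finite_dist_le N) hmono
      nlinarith [G.one_le_card N]
  have hgeom : Summable fun n : ℕ => c * Real.exp s * Real.exp (t - s) ^ n :=
    (summable_geometric_of_lt_one (Real.exp_nonneg _)
      (Real.exp_lt_one_iff.2 (by linarith))).mul_left _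
  refine summable_of_sum_le (fun x => Real.exp_nonneg _)
    (c := ∑' n : ℕ, c * Real.exp s * Real.exp (t - s) ^ n) fun u => ?_
  classical
  rw [← Finset.sum_fiberwise_of_maps_to (t := u.image fun x => ⌈d 1 x⌉₊)
    (g := fun x => ⌈d 1 x⌉₊) fun x hx => Finset.mem_image_of_mem _ hx]
  refine le_trans (Finset.sum_le_sum fun n _ => ?_)
    (hgeom.sum_le_tsum _ fun n _ => by positivity)
  have hterm : ∀ x ∈ u.filter (fun x => ⌈d 1 x⌉₊ = n),
      Real.exp (-s * d 1 x) ≤ Real.exp (-s * (n - 1)) := by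
    intro x hx
    obtain ⟨-, rfl⟩ := Finset.mem_filter.1 hx
    have := Nat.ceil_lt_add_one (G.nonneg 1 x)
    rw [Real.exp_le_exp]
    nlinarith
  refine (Finset.sum_le_card_nsmul _ _ _ hterm).trans ?_
  have hcard : ((u.filter fun x => ⌈d 1 x⌉₊ = n).card : ℝ) ≤
      Nat.card {x : Γ // d 1 x ≤ (n : ℝ)} := by
    have hsub : ((u.filter fun x => ⌈d 1 x⌉₊ = n : Finset Γ) : Set Γ) ⊆
        {x : Γ | d 1 x ≤ (n : ℝ)} := by
      intro x hx
      obtain ⟨-, rfl⟩ := Finset.mem_filter.1 hx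
      exact Nat.le_ceil (d 1 x)
    have := Nat.card_mono (G.finite_dist_le n) hsub
    rw [Nat.card_coe_set_eq, Set.ncard_coe_finset] at this
    exact_mod_cast this
  rw [nsmul_eq_mul]
  calc _ ≤ c * Real.exp (t * n) * Real.exp (-s * (n - 1)) := by
        gcongr
        exact hcard.trans (hc n)
    _ = c * Real.exp s * Real.exp (t - s) ^ n := by
        rw [← Real.exp_nat_mul, mul_assoc, mul_assoc, ← Real.exp_add, ← Real.exp_add]
        ring_nf

theorem growthRate_le_of_summable {s : ℝ} (hs : 0 ≤ s)
    (hsum : Summable fun x => Real.exp (-s * d 1 x)) : growthRate d ≤ s := by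
  set T := ∑' x, Real.exp (-s * d 1 x) with hT
  have hcard : ∀ n : ℕ, (Nat.card {x : Γ // d 1 x ≤ (n : ℝ)} : ℝ) * Real.exp (-s * n) ≤ T := by
    intro n
    have h1 := hsum.sum_le_tsum (G.finite_dist_le n).toFinset fun x _ => (Real.exp_nonneg _)
    refine le_trans ?_ h1
    have h2 := Finset.card_nsmul_le_sum (G.finite_dist_le n).toFinset
      (fun x => Real.exp (-s * d 1 x)) (Real.exp (-s * n)) fun x hx => by
        rw [Set.Finite.mem_toFinset, Set.mem_ofPred_eq] at hx
        rw [Real.exp_le_exp]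
        nlinarith
    rwa [nsmul_eq_mul, ← Nat.card_eq_card_finite_toFinset] at h2
  have hlim : Tendsto (fun n : ℕ => s + Real.log T / n) atTop (𝓝 s) := by
    simpa using (tendsto_const_nhds (x := s)).add
      ((tendsto_const_nhds (x := Real.log T)).div_atTop (tendsto_natCast_atTop_atTop (R := ℝ)))
  rw [← hlim.limsup_eq]
  refine limsup_le_limsup ?_ (isBoundedUnder_of ⟨0, G.log_card_nonneg⟩).isCoboundedUnder_le
    hlim.isBoundedUnder_le
  filter_upwards [eventually_gt_atTop 0] with n hn
  have hn' : (0 : ℝ) < n := by exact_mod_cast hn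
  have h1 := G.one_le_card n
  have h2 := Real.log_le_log (by positivity) (hcard n)
  rw [Real.log_mul (by positivity) (Real.exp_ne_zero _), Real.log_exp] at h2
  rw [div_le_iff₀ hn', add_mul, div_mul_cancel₀ _ hn'.ne']
  linarith

theorem exists_sphSum_lt_one {s : ℝ} (hsum : Summable fun x => Real.exp (-s * d 1 x)) :
    ∃ N, ∀ n, N < n → sphSum d S s n < 1 := by
  classical
  obtain ⟨u, hu⟩ := summable_iff_vanishing_norm.1 hsum 1 one_pos
  obtain ⟨N, hN⟩ := (u.image (wordLength S)).bddAbove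
  refine ⟨N, fun n hn => ?_⟩
  rw [G.sphSum_eq]
  refine (le_abs_self _).trans_lt (hu _ (Finset.disjoint_left.2 fun x hx hxu => ?_))
  rw [G.mem_sphere] at hx
  have : wordLength S x ≤ N := hN (by simpa using ⟨x, hxu, rfl⟩)
  omega

theorem summable_of_sum_sphSum_le {s c : ℝ}
    (hc : ∀ N, ∃ N', N ≤ N' ∧ ∑ m ∈ Finset.range N', sphSum d S s m ≤ c) :
    Summable fun x => Real.exp (-s * d 1 x) := by
  classical
  refine summable_of_sum_le (fun x => Real.exp_nonneg _) (c := c) fun u => ?_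
  obtain ⟨N, hN⟩ := (u.image (wordLength S)).bddAbove
  obtain ⟨N', hNN', hN'⟩ := hc (N + 1)
  refine le_trans ?_ hN'
  rw [← Finset.sum_fiberwise_of_maps_to (t := Finset.range N') (g := wordLength S) fun x hx => by
    have : wordLength S x ≤ N := hN (by simpa using ⟨x, hx, rfl⟩)
    rw [Finset.mem_range]
    omega]
  refine Finset.sum_le_sum fun n _ => ?_
  rw [G.sphSum_eq]
  refine Finset.sum_le_sum_of_subset_of_nonneg (fun x hx => ?_) fun _ _ _ => Real.exp_nonneg _
  rw [G.mem_sphere]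
  exact (Finset.mem_filter.1 hx).2

theorem exists_sphSum_le (hvc : ¬ VirtuallyCyclic Γ) :
    ∃ c, ∀ n, sphSum d S (growthRate d) n ≤ c := by
  obtain ⟨R, Q, A, hQ, hA, hmul⟩ := G.exists_le_sphSum_add hvc
  have hv := G.growthRate_nonneg
  have hQ' : (1 : ℝ) ≤ Q := by exact_mod_cast hQ
  have hupper : ∀ n, sphSum d S (growthRate d) (n + 1 + R) ≤
      Q * Real.exp (growthRate d * A) := by
    intro n
    by_contra! hlt
    have hcont : Continuous fun s => (Q : ℝ) * Real.exp (s * A) := by fun_prop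
    have hev := (hcont.tendsto (growthRate d)).eventually_lt
      ((G.continuous_sphSum (n + 1 + R)).tendsto _) hlt
    obtain ⟨s, hs, hvs⟩ :=
      ((hev.filter_mono nhdsWithin_le_nhds).and (self_mem_nhdsWithin (s := Set.Ioi (growthRate d)))).exists
    have hs0 : 0 ≤ s := hv.trans (le_of_lt hvs)
    have hexp : 1 ≤ Real.exp (s * A) := Real.one_le_exp (by positivity)
    set q := (Q : ℝ) * Real.exp (s * A) with hq
    have hq1 : 1 ≤ q := by nlinarith
    have hiter : ∀ k : ℕ, q ≤ sphSum d S s ((k + 1) * (n + 1) + R) := by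
      intro k
      induction k with
      | zero => simpa using hs.le
      | succ k ih =>
        have h1 := hmul s hs0 ((k + 1) * (n + 1)) (n + 1)
        rw [← hq] at h1
        have e : (k + 1) * (n + 1) + (n + 1) = (k + 1 + 1) * (n + 1) := by ring
        rw [e] at h1
        have h2 : q * q ≤ q * sphSum d S s ((k + 1 + 1) * (n + 1) + R) :=
          le_trans (mul_le_mul ih hs.le (by positivity) (G.sphSum_nonneg _ _)) h1
        exact le_of_mul_le_mul_left h2 (by positivity)
    obtain ⟨N, hN⟩ := G.exists_sphSum_lt_one (G.summable_of_growthRate_lt hvs)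
    have h1 := hN ((N + 1) * (n + 1) + R) (by nlinarith)
    linarith [hiter N]
  refine ⟨Q * Real.exp (growthRate d * A) +
    ∑ m ∈ Finset.range (R + 1), sphSum d S (growthRate d) m, fun n => ?_⟩
  have hsum0 : 0 ≤ ∑ m ∈ Finset.range (R + 1), sphSum d S (growthRate d) m :=
    Finset.sum_nonneg fun m _ => G.sphSum_nonneg _ m
  rcases le_or_gt n R with h | h
  · have h1 := Finset.single_le_sum (f := sphSum d S (growthRate d))
      (fun m _ => G.sphSum_nonneg _ m) (Finset.mem_range.2 (Nat.lt_succ_of_le h))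
    have : 0 ≤ Q * Real.exp (growthRate d * A) := by positivity
    linarith
  · obtain ⟨k, rfl⟩ := Nat.exists_eq_add_of_lt h
    have h1 := hupper k
    have e : k + 1 + R = R + k + 1 := by ring
    rw [e] at h1
    linarith

theorem sphere_nonempty [Infinite Γ] (n : ℕ) : (G.sphere n).Nonempty := by
  obtain ⟨x, hx⟩ := (finite_ball G.symmGen n).exists_notMem
  obtain ⟨p, hp⟩ := exists_wordGeod G.symmGen x
  exact ⟨p n, G.mem_sphere.2 (hp.length_eq (not_le.1 hx).le)⟩

theorem le_sphSum [Infinite Γ] (n : ℕ) :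
    Real.exp (-growthRate d * K) ≤ sphSum d S (growthRate d) n := by
  have hv := G.growthRate_nonneg
  have hK := G.hK
  suffices h : 1 ≤ Real.exp (growthRate d * K) * sphSum d S (growthRate d) n by
    rw [neg_mul, Real.exp_neg]
    exact (inv_le_iff_one_le_mul₀' (Real.exp_pos _)).2 h
  rcases hv.eq_or_lt with hv0 | hv0
  · rw [← hv0, G.sphSum_eq]
    have := (G.sphere_nonempty n).card_pos
    simpa using this
  by_contra! hlt
  have hn : n ≠ 0 := by
    rintro rfl
    have h1 : 1 ≤ sphSum d S (growthRate d) 0 := by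
      rw [G.sphSum_eq]
      refine le_trans ?_ (Finset.single_le_sum (fun x _ => Real.exp_nonneg _)
        (G.mem_sphere.2 (wordLength_one (S := S))))
      simp [G.metric.refl]
    have h2 : 1 ≤ Real.exp (growthRate d * K) := Real.one_le_exp (by positivity)
    nlinarith
  have hcont : Continuous fun s => Real.exp (s * K) * sphSum d S s n := by
    have := G.continuous_sphSum n
    fun_prop
  have hev := (hcont.tendsto (growthRate d)).eventually_lt_const hlt
  obtain ⟨s, ⟨hs, hs0⟩, hsv⟩ := (((hev.and (lt_mem_nhds hv0)).filter_mono
    nhdsWithin_le_nhds).and (self_mem_nhdsWithin (s := Set.Iio (growthRate d)))).exists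
  refine absurd (G.growthRate_le_of_summable hs0.le ?_) (not_le.2 hsv)
  set b : ℕ → ℝ := fun m => Real.exp (s * K) * sphSum d S s m with hb
  have hb0 : ∀ m, 0 ≤ b m := fun m => mul_nonneg (Real.exp_nonneg _) (G.sphSum_nonneg _ _)
  have hbn : b n < 1 := hs
  have hle : ∀ m, sphSum d S s m ≤ b m := fun m =>
    le_mul_of_one_le_left (G.sphSum_nonneg _ _) (Real.one_le_exp (by positivity))
  set T := ∑ m ∈ Finset.range n, b m with hT
  have hT0 : 0 ≤ T := Finset.sum_nonneg fun m _ => hb0 m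
  have hbound : ∀ q : ℕ, ∑ m ∈ Finset.range (q * n), b m ≤ T / (1 - b n) := by
    intro q
    rw [le_div_iff₀ (by linarith)]
    induction q with
    | zero => simpa using hT0
    | succ q ih =>
      have h1 : ∑ m ∈ Finset.range (q * n), b (n + m) ≤
          b n * ∑ m ∈ Finset.range (q * n), b m := by
        rw [Finset.mul_sum]
        refine Finset.sum_le_sum fun m _ => ?_
        have h2 := mul_le_mul_of_nonneg_left (G.sphSum_add_le hs0.le n m) (Real.exp_nonneg (s * K))
        simp only [hb]
        linarith
      have e : (q + 1) * n = n + q * n := by ring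
      rw [e, Finset.sum_range_add]
      nlinarith [hb0 n]
  refine G.summable_of_sum_sphSum_le (c := T / (1 - b n)) fun N => ⟨N * n, ?_, ?_⟩
  · exact Nat.le_mul_of_pos_right N (Nat.pos_of_ne_zero hn)
  · exact (Finset.sum_le_sum fun m _ => hle m).trans (hbound N)

end GroupGeom

end GrowthRate

end HypFlow

namespace HypFlow

section Statements

open MeasureTheory Filter Topology
open scoped ENNReal

theorem stmt6 {Γ : Type*} [Group Γ]
    (hΓ : NonElemHyperbolic Γ)
    (d : Γ → Γ → ℝ) (hd : InD d)
    (S : Set Γ) (hS : IsSymmGen S) :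
    ∃ c₁ c₂ : ℝ, 0 < c₁ ∧ 0 < c₂ ∧ ∀ n : ℕ,
      c₁ ≤ (∑' x : {x : Γ // wordLength S x = n}, Real.exp (-(growthRate d) * d 1 x)) ∧
      (∑' x : {x : Γ // wordLength S x = n}, Real.exp (-(growthRate d) * d 1 x)) ≤ c₂ := by
  obtain ⟨δ, L, C, K, G⟩ := exists_groupGeom hd hS
  have := infinite_of_not_virtuallyCyclic hΓ.2
  obtain ⟨c, hc⟩ := G.exists_sphSum_le hΓ.2
  have hlow := G.le_sphSum
  exact ⟨_, c, Real.exp_pos _, (Real.exp_pos _).trans_le ((hlow 0).trans (hc 0)),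
    fun n => ⟨hlow n, hc n⟩⟩

end Statements

end HypFlow
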